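/- arXiv:1806.01311 — 2 statements merged into one kernel-verified Lean document; each statement's English description precedes it below -/
import Mathlib

section
/- Assume hypotheses (V) and (K). Suppose there exists R₂ > 0 such that V(r) < +∞ for almost every r > R₂, ess sup_{r>R₂} K(r)/(r^{α_∞} V(r)^{β_∞}) < +∞ for some 0 ≤ β_∞ ≤ 1 and α_∞ ∈ ℝ, and ess inf_{r>R₂} r^{γ_∞} V(r) > 0 for some γ_∞ ≤ 4. Then lim_{R→+∞} R_∞(q₂,R) = 0 for every q₂ ∈ ℝ with q₂ > max{1, 2β_∞, q_*(α_∞,β_∞,γ_∞), q_{**}(α_∞,β_∞,γ_∞)}. -/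
open MeasureTheory Filter Topology Set ENNReal

noncomputable section

/-- Euclidean space `ℝ^N`. -/
abbrev E (N : ℕ) := EuclideanSpace ℝ (Fin N)

/-- The (classical) Laplacian of a function `φ : ℝ^N → ℝ`. -/
def lapl {N : ℕ} (φ : E N → ℝ) (x : E N) : ℝ :=
  ∑ i : Fin N, fderiv ℝ (fun y => fderiv ℝ φ y (EuclideanSpace.single i 1)) x
    (EuclideanSpace.single i 1)

/-- A function is radial if it depends only on the norm. -/
def IsRadial {N : ℕ} (u : E N → ℝ) : Prop := ∀ x y : E N, ‖x‖ = ‖y‖ → u x = u y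

/-- The critical exponent `2** = 2N/(N-4)` as an element of `ℝ≥0∞`. -/
def twoSS (N : ℕ) : ℝ≥0∞ := (2 * N : ℝ≥0∞) / ((N : ℝ≥0∞) - 4)

/-- `u ∈ D^{2,2}(ℝ^N)` with (distributional) Laplacian `w`: `u` lies in `L^{2**}`,
`w ∈ L²`, and `u` is the limit in `L^{2**}` of smooth compactly supported functions whose
Laplacians converge to `w` in `L²` (i.e. `u` lies in the closure of `C_c^∞` for the norm
`‖Δ·‖_{L²}`, with `Δu = w`). -/
def MemD22 (N : ℕ) (u w : E N → ℝ) : Prop :=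
  MemLp u (twoSS N) volume ∧ MemLp w 2 volume ∧
  ∃ φ : ℕ → E N → ℝ,
    (∀ n, ContDiff ℝ (⊤ : ℕ∞) (φ n) ∧ HasCompactSupport (φ n)) ∧
    Tendsto (fun n => eLpNorm (fun x => φ n x - u x) (twoSS N) volume) atTop (𝓝 0) ∧
    Tendsto (fun n => eLpNorm (fun x => lapl (φ n) x - w x) 2 volume) atTop (𝓝 0)

/-- `u ∈ H²_V(ℝ^N)` (with Laplacian `w`). -/
def MemH2V {N : ℕ} (V : ℝ → ℝ≥0∞) (u w : E N → ℝ) : Prop :=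
  MemD22 N u w ∧ (∫⁻ x : E N, V ‖x‖ * ENNReal.ofReal ((u x) ^ 2)) < ⊤

/-- `u ∈ H²_{V,r}(ℝ^N)`: member of `H²_V` which is radial. -/
def MemH2Vr {N : ℕ} (V : ℝ → ℝ≥0∞) (u w : E N → ℝ) : Prop :=
  MemH2V V u w ∧ IsRadial u

/-- The norm of `H²_V`: `‖u‖ = (∫ |Δu|² + V(|x|)u²)^{1/2}` (here `w = Δu`). -/
def H2norm {N : ℕ} (V : ℝ → ℝ≥0∞) (u w : E N → ℝ) : ℝ :=
  (((∫⁻ x : E N, ENNReal.ofReal ((w x) ^ 2)) +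
    ∫⁻ x : E N, V ‖x‖ * ENNReal.ofReal ((u x) ^ 2)).toReal) ^ (1/2 : ℝ)

/-- Hypothesis (V): `V : (0,∞) → [0,∞]` measurable and locally integrable on `(0,∞)`. -/
def HypV (V : ℝ → ℝ≥0∞) : Prop :=
  Measurable V ∧ ∀ a b : ℝ, 0 < a → (∫⁻ r in Set.Icc a b, V r) < ⊤

/-- Hypothesis (K): `K : (0,∞) → (0,∞)` measurable with `K ∈ L^s_loc((0,∞))`. -/
def HypK (K : ℝ → ℝ) (s : ℝ) : Prop :=
  (∀ r : ℝ, 0 < r → 0 < K r) ∧ Measurable K ∧ 1 < s ∧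
  ∀ a b : ℝ, 0 < a → IntegrableOn (fun r => K r ^ s) (Set.Icc a b) volume

/-- The quantity `S₀(q,R)`. -/
def S0 (N : ℕ) (V : ℝ → ℝ≥0∞) (K : ℝ → ℝ) (q R : ℝ) : ℝ≥0∞ :=
  ⨆ p : {p : (E N → ℝ) × (E N → ℝ) // MemH2Vr V p.1 p.2 ∧ H2norm V p.1 p.2 = 1},
    ∫⁻ x in Metric.ball (0 : E N) R, ENNReal.ofReal (K ‖x‖ * |p.1.1 x| ^ q)

/-- The quantity `S_∞(q,R)`. -/
def Sinf (N : ℕ) (V : ℝ → ℝ≥0∞) (K : ℝ → ℝ) (q R : ℝ) : ℝ≥0∞ :=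
  ⨆ p : {p : (E N → ℝ) × (E N → ℝ) // MemH2Vr V p.1 p.2 ∧ H2norm V p.1 p.2 = 1},
    ∫⁻ x in (Metric.ball (0 : E N) R)ᶜ, ENNReal.ofReal (K ‖x‖ * |p.1.1 x| ^ q)

/-- The quantity `R₀(q,R)`. -/
def R0 (N : ℕ) (V : ℝ → ℝ≥0∞) (K : ℝ → ℝ) (q R : ℝ) : ℝ≥0∞ :=
  ⨆ p : {p : ((E N → ℝ) × (E N → ℝ)) × ((E N → ℝ) × (E N → ℝ)) //
      MemH2Vr V p.1.1 p.1.2 ∧ MemH2Vr V p.2.1 p.2.2 ∧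
      H2norm V p.1.1 p.1.2 = 1 ∧ H2norm V p.2.1 p.2.2 = 1},
    ∫⁻ x in Metric.ball (0 : E N) R,
      ENNReal.ofReal (K ‖x‖ * |p.1.1.1 x| ^ (q - 1) * |p.1.2.1 x|)

/-- The quantity `R_∞(q,R)`. -/
def Rinf (N : ℕ) (V : ℝ → ℝ≥0∞) (K : ℝ → ℝ) (q R : ℝ) : ℝ≥0∞ :=
  ⨆ p : {p : ((E N → ℝ) × (E N → ℝ)) × ((E N → ℝ) × (E N → ℝ)) //
      MemH2Vr V p.1.1 p.1.2 ∧ MemH2Vr V p.2.1 p.2.2 ∧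
      H2norm V p.1.1 p.1.2 = 1 ∧ H2norm V p.2.1 p.2.2 = 1},
    ∫⁻ x in (Metric.ball (0 : E N) R)ᶜ,
      ENNReal.ofReal (K ‖x‖ * |p.1.1.1 x| ^ (q - 1) * |p.1.2.1 x|)

/-- The weighted measure `K(|x|)dx`. -/
def Kmeas (N : ℕ) (K : ℝ → ℝ) : Measure (E N) :=
  volume.withDensity (fun x => ENNReal.ofReal (K ‖x‖))

/-- Membership in the sum space `L^{q₁}_K + L^{q₂}_K`. -/
def MemSum (N : ℕ) (K : ℝ → ℝ) (q1 q2 : ℝ) (u : E N → ℝ) : Prop :=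
  ∃ u1 u2 : E N → ℝ, u = u1 + u2 ∧ MemLp u1 (ENNReal.ofReal q1) (Kmeas N K) ∧
    MemLp u2 (ENNReal.ofReal q2) (Kmeas N K)

/-- The norm of the sum space `L^{q₁}_K + L^{q₂}_K`. -/
def sumNorm (N : ℕ) (K : ℝ → ℝ) (q1 q2 : ℝ) (u : E N → ℝ) : ℝ≥0∞ :=
  ⨅ p : {p : (E N → ℝ) × (E N → ℝ) // u = p.1 + p.2},
    max (eLpNorm p.1.1 (ENNReal.ofReal q1) (Kmeas N K))
        (eLpNorm p.1.2 (ENNReal.ofReal q2) (Kmeas N K))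

/-- `σ_N`, the (N-1)-dimensional measure of the unit sphere, i.e. `N·ω_N`. -/
def sigmaN (N : ℕ) : ℝ := N * (volume (Metric.ball (0 : E N) 1)).toReal

end

noncomputable section

/-- `q_*(α,β,γ) = 2(α-γβ+N)/(N-γ)`. -/
def qLow (N : ℕ) (α β γ : ℝ) : ℝ := 2 * (α - γ*β + N) / (N - γ)

/-- `q_{**}(α,β,γ) = 2(2α+(1-2β)γ+2(N-2))/(2(N-2)-γ)`. -/
def qHigh (N : ℕ) (α β γ : ℝ) : ℝ := 2 * (2*α + (1-2*β)*γ + 2*(N-2)) / (2*(N-2) - γ)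

lemma contDiff_dir {N : ℕ} {φ : E N → ℝ} {n m : WithTop ℕ∞} (h : ContDiff ℝ n φ) (hm : m + 1 ≤ n) (e : E N) :
    ContDiff ℝ m (fun y => fderiv ℝ φ y e) :=
  (h.fderiv_right hm).clm_apply contDiff_const

lemma hcs_dir {N : ℕ} {φ : E N → ℝ} (h : HasCompactSupport φ) (e : E N) :
    HasCompactSupport (fun y => fderiv ℝ φ y e) := by
  exact h.fderiv_apply (𝕜 := ℝ) e

lemma ibp_dir {N : ℕ} {φ ψ : E N → ℝ} (hφ : ContDiff ℝ 1 φ) (hψ : ContDiff ℝ 1 ψ)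
    (hφc : HasCompactSupport φ) (e : E N) :
    ∫ x, φ x * fderiv ℝ ψ x e = - ∫ x, fderiv ℝ φ x e * ψ x := by
  have h1 : Continuous (fun x => fderiv ℝ φ x e) :=
    (contDiff_dir (m := 0) hφ (by simp) e).continuous
  have h2 : Continuous (fun x => fderiv ℝ ψ x e) :=
    (contDiff_dir (m := 0) hψ (by simp) e).continuous
  apply integral_mul_fderiv_eq_neg_fderiv_mul_of_integrable
  · exact (h1.mul hψ.continuous).integrable_of_hasCompactSupport ((hcs_dir hφc e).mul_right)
  · exact (hφ.continuous.mul h2).integrable_of_hasCompactSupport (hφc.mul_right)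
  · exact (hφ.continuous.mul hψ.continuous).integrable_of_hasCompactSupport (hφc.mul_right)
  · exact fun x _ => (hφ.differentiable (by simp)) x
  · exact fun x _ => (hψ.differentiable (by simp)) x

lemma lapl_continuous {N : ℕ} {φ : E N → ℝ} (hφ : ContDiff ℝ 2 φ) : Continuous (lapl φ) := by
  unfold lapl
  refine continuous_finsetSum _ fun i _ => ?_
  exact (contDiff_dir (m := 0) (contDiff_dir (m := 1) hφ (by norm_num) _) (by simp) _).continuous

lemma lapl_hcs {N : ℕ} {φ : E N → ℝ} (hφ : HasCompactSupport φ) : HasCompactSupport (lapl φ) := by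
  apply HasCompactSupport.intro (K := tsupport φ) hφ
  intro x hx
  unfold lapl
  refine Finset.sum_eq_zero fun i _ => ?_
  have h1 : x ∉ tsupport (fun y => fderiv ℝ φ y (EuclideanSpace.single i 1)) :=
    fun h => hx ((tsupport_fderiv_apply_subset ℝ _) h)
  by_contra h
  exact h1 ((tsupport_fderiv_apply_subset ℝ (EuclideanSpace.single i 1)) (subset_tsupport _ h))

lemma ibp_lapl {N : ℕ} {φ ψ : E N → ℝ} (hφ : ContDiff ℝ 2 φ) (hψ : ContDiff ℝ 2 ψ)
    (hφc : HasCompactSupport φ) (hψc : HasCompactSupport ψ) :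
    ∫ x, φ x * lapl ψ x = ∫ x, lapl φ x * ψ x := by
  unfold lapl
  simp only [Finset.mul_sum, Finset.sum_mul]
  have one2 : (1 : WithTop ℕ∞) ≤ 2 := by norm_num
  have c1 : ∀ i : Fin N, ContDiff ℝ 1 (fun y => fderiv ℝ φ y (EuclideanSpace.single i 1)) :=
    fun i => contDiff_dir hφ (by norm_num) _
  have c2 : ∀ i : Fin N, ContDiff ℝ 1 (fun y => fderiv ℝ ψ y (EuclideanSpace.single i 1)) :=
    fun i => contDiff_dir hψ (by norm_num) _
  rw [integral_finsetSum, integral_finsetSum]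
  · refine Finset.sum_congr rfl fun i _ => ?_
    rw [ibp_dir (hφ.of_le one2) (c2 i) hφc, ibp_dir (c1 i) (hψ.of_le one2) (hcs_dir hφc _)] 
    simp
  · intro i _
    exact (((contDiff_dir (m := 0) (c1 i) (by simp) _).continuous).mul
      hψ.continuous).integrable_of_hasCompactSupport (hψc.mul_left)
  · intro i _
    exact (hφ.continuous.mul ((contDiff_dir (m := 0) (c2 i) (by simp) _).continuous)
      ).integrable_of_hasCompactSupport (hφc.mul_right)

lemma one_le_twoSS {N : ℕ} (hN : 5 ≤ N) : 1 ≤ twoSS N := by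
  unfold twoSS
  rw [ENNReal.le_div_iff_mul_le]
  · rw [one_mul]
    refine tsub_le_self.trans ?_
    rw [two_mul]; exact le_self_add
  · left
    have : (4 : ℝ≥0∞) < N := by exact_mod_cast (by omega : 4 < N)
    exact (tsub_pos_of_lt this).ne'
  · left
    exact ne_top_of_le_ne_top (ENNReal.natCast_ne_top N) tsub_le_self

lemma tendsto_integral_mul {N : ℕ} {p : ℝ≥0∞} (hp : 1 ≤ p) {f : ℕ → E N → ℝ} {u ψ : E N → ℝ}
    (hf : ∀ n, MemLp (f n) p volume) (hu : MemLp u p volume)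
    (hlim : Tendsto (fun n => eLpNorm (fun x => f n x - u x) p volume) atTop (𝓝 0))
    (hψ : Continuous ψ) (hψc : HasCompactSupport ψ) :
    Integrable (fun x => u x * ψ x) ∧
    Tendsto (fun n => ∫ x, f n x * ψ x) atTop (𝓝 (∫ x, u x * ψ x)) := by
  obtain ⟨q, hq⟩ : ∃ q : ℝ≥0∞, ENNReal.HolderConjugate p q :=
    ⟨_, ENNReal.HolderConjugate.conjExponent hp⟩
  have hψq : MemLp ψ q volume := hψ.memLp_of_hasCompactSupport hψc
  have hInt : ∀ g : E N → ℝ, MemLp g p volume → Integrable (fun x => g x * ψ x) := by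
    intro g hg
    exact hg.integrable_mul hψq
  refine ⟨hInt u hu, ?_⟩
  have key : ∀ n, ENNReal.ofReal |(∫ x, f n x * ψ x) - ∫ x, u x * ψ x| ≤
      eLpNorm (fun x => f n x - u x) p volume * eLpNorm ψ q volume := by
    intro n
    rw [← integral_sub (hInt _ (hf n)) (hInt _ hu)]
    have h1 : eLpNorm (fun x => (f n x - u x) * ψ x) 1 volume ≤ 
      eLpNorm (fun x => f n x - u x) p volume * eLpNorm ψ q volume := by
      have h2 := eLpNorm_smul_le_mul_eLpNorm (p := p) (q := q) (r := 1) (μ := volume) hψq.1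
        ((hf n).1.sub hu.1)
      exact h2
    refine le_trans ?_ h1
    rw [← Real.norm_eq_abs, ofReal_norm, eLpNorm_one_eq_lintegral_enorm]
    have : (fun x => f n x * ψ x - u x * ψ x) = fun x => (f n x - u x) * ψ x := by
      ext x; ring
    rw [this]
    exact enorm_integral_le_lintegral_enorm _
  rw [tendsto_iff_edist_tendsto_0]
  have h0 : Tendsto (fun n => eLpNorm (fun x => f n x - u x) p volume * eLpNorm ψ q volume) atTop
      (𝓝 0) := by
    have := ENNReal.Tendsto.mul_const (b := eLpNorm ψ q volume) hlim (Or.inr hψq.2.ne)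
    simpa using this
  refine tendsto_of_tendsto_of_tendsto_of_le_of_le tendsto_const_nhds h0 (fun _ => zero_le) ?_
  intro n
  simp only [edist_dist, Real.dist_eq]
  exact key n

lemma test_identity {N : ℕ} (hN : 5 ≤ N) {u w ψ : E N → ℝ} (h : MemD22 N u w)
    (hψ : ContDiff ℝ 2 ψ) (hψc : HasCompactSupport ψ) :
    Integrable (fun x => u x * lapl ψ x) ∧ Integrable (fun x => w x * ψ x) ∧ 
    ∫ x, u x * lapl ψ x = ∫ x, w x * ψ x := by
  obtain ⟨hu, hw, φ, hφ, h1, h2⟩ := h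
  have hφ2 : ∀ n, ContDiff ℝ 2 (φ n) := fun n => (hφ n).1.of_le (by
    have : (((2 : ℕ∞) : WithTop ℕ∞)) ≤ ((⊤ : ℕ∞) : WithTop ℕ∞) := WithTop.coe_le_coe.2 le_top
    exact this)
  have a1 := tendsto_integral_mul (one_le_twoSS hN)
    (fun n => (hφ2 n).continuous.memLp_of_hasCompactSupport (hφ n).2) hu h1
    (lapl_continuous hψ) (lapl_hcs hψc)
  have a2 := tendsto_integral_mul (by norm_num)
    (fun n => (lapl_continuous (hφ2 n)).memLp_of_hasCompactSupport (lapl_hcs (hφ n).2)) hw h2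
    hψ.continuous hψc
  refine ⟨a1.1, a2.1, tendsto_nhds_unique a1.2 ?_⟩
  refine a2.2.congr fun n => ?_
  exact (ibp_lapl (hφ2 n) hψ (hφ n).2 hψc).symm

lemma lapl_radial {N : ℕ} {G G1 G2 : ℝ → ℝ} (h1 : ∀ t, HasDerivAt G (G1 t) t)
    (h2 : ∀ t, HasDerivAt G1 (G2 t) t) (x : E N) :
    lapl (fun x : E N => G (‖x‖ ^ 2)) x = 4 * ‖x‖ ^ 2 * G2 (‖x‖ ^ 2) + 2 * N * G1 (‖x‖ ^ 2) := by
  have hn : ∀ y : E N, HasFDerivAt (fun x : E N => ‖x‖ ^ 2) (2 • (innerSL ℝ y)) y := fun y =>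
    (hasStrictFDerivAt_norm_sq y).hasFDerivAt
  have e1 : ∀ i : Fin N, (fun y : E N => fderiv ℝ (fun x : E N => G (‖x‖ ^ 2)) y
      (EuclideanSpace.single i 1)) = fun y => G1 (‖y‖ ^ 2) * (2 * y i) := by
    intro i
    ext y
    have := (h1 (‖y‖ ^ 2)).comp_hasFDerivAt y (hn y)
    have this' : HasFDerivAt (fun x : E N => G (‖x‖ ^ 2)) _ y := this
    rw [HasFDerivAt.fderiv this']
    simp [EuclideanSpace.inner_single_right]
  unfold lapl
  simp only [e1]
  have e2 : ∀ i : Fin N, fderiv ℝ (fun y : E N => G1 (‖y‖ ^ 2) * (2 * y i)) x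
      (EuclideanSpace.single i 1) = 4 * G2 (‖x‖ ^ 2) * (x i) ^ 2 + 2 * G1 (‖x‖ ^ 2) := by
    intro i
    have a := (h2 (‖x‖ ^ 2)).comp_hasFDerivAt x (hn x)
    have b : HasFDerivAt (fun y : E N => 2 * y i) ((2 : ℝ) • (EuclideanSpace.proj i : E N →L[ℝ] ℝ)) x :=
      ((EuclideanSpace.proj i : E N →L[ℝ] ℝ).hasFDerivAt).const_mul 2
    have := a.mul b
    have this' : HasFDerivAt (fun y : E N => G1 (‖y‖ ^ 2) * (2 * y i)) _ x := this
    rw [HasFDerivAt.fderiv this']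
    simp [EuclideanSpace.inner_single_right]
    ring
  simp only [e2]
  rw [Finset.sum_add_distrib, ← Finset.mul_sum, EuclideanSpace.norm_sq_eq]
  simp
  ring

lemma exists_test {N : ℕ} (hN : 5 ≤ N) {h h0 : ℝ → ℝ} {a δ : ℝ} (hδ : 0 < δ) (hδa : δ ≤ a / 2)
    (hh : ContDiff ℝ 1 h) (hd : ∀ t, HasDerivAt h (h0 t) t)
    (hz : ∀ t, t ≤ a - δ ∨ a + δ ≤ t → h t = 0) (hb : ∀ t, |h t| ≤ 1) :
    ∃ ψ : E N → ℝ, ContDiff ℝ 2 ψ ∧ HasCompactSupport ψ ∧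
      (∀ x, lapl ψ x = h0 ‖x‖ / ‖x‖ ^ (N - 1)) ∧
      ∫ x, (ψ x) ^ 2 ≤ (2 ^ (N + 1) * δ * a / a ^ N) ^ 2 * ((2 * a) ^ N *
        volume.real (Metric.ball (0 : E N) 1)) := by
  have ha : 0 < a := by linarith
  have had : 0 < a - δ := by linarith
  set g1 : ℝ → ℝ := fun t => h (√t) / (2 * (√t) ^ N) with hg1
  have g1_zero_low : ∀ t, t ≤ (a - δ) ^ 2 → g1 t = 0 := by
    intro t ht
    have : √t ≤ a - δ := by
      rw [Real.sqrt_le_left had.le]; exact ht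
    simp [hg1, hz _ (Or.inl this)]
  have g1_zero_high : ∀ t, (a + δ) ^ 2 ≤ t → g1 t = 0 := by
    intro t ht
    have : a + δ ≤ √t := Real.le_sqrt_of_sq_le ht
    simp [hg1, hz _ (Or.inr this)]
  have g1_low_ev : ∀ t, t < (a - δ) ^ 2 → g1 =ᶠ[𝓝 t] fun _ => 0 := by
    intro t ht
    filter_upwards [Iio_mem_nhds ht] with s hs
    exact g1_zero_low s (le_of_lt hs)
  have g1_cd : ContDiff ℝ 1 g1 := by
    rw [contDiff_iff_contDiffAt]
    intro t
    rcases lt_or_ge t ((a - δ) ^ 2) with ht | ht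
    · exact contDiffAt_const.congr_of_eventuallyEq (g1_low_ev t ht)
    · have htpos : 0 < t := lt_of_lt_of_le (by positivity) ht
      have hs : ContDiffAt ℝ 1 (fun t : ℝ => √t) t := Real.contDiffAt_sqrt htpos.ne'
      refine ContDiffAt.div (hh.contDiffAt.comp t hs) (contDiffAt_const.mul (hs.pow N)) ?_
      have := Real.sqrt_pos.2 htpos
      positivity
  have g1_cont : Continuous g1 := g1_cd.continuous
  have g1_d : ∀ t, HasDerivAt g1 (deriv g1 t) t := fun t =>
    ((g1_cd.differentiable (by simp)) t).hasDerivAt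
  set T := (a + δ) ^ 2 with hT
  set G : ℝ → ℝ := fun t => ∫ s in T..t, g1 s with hG
  have G_d : ∀ t, HasDerivAt G (g1 t) t := fun t =>
    (g1_cont.integral_hasStrictDerivAt T t).hasDerivAt
  have G_deriv : deriv G = g1 := funext fun t => (G_d t).deriv
  have G_cd : ContDiff ℝ 2 G := by
    rw [show (2 : WithTop ℕ∞) = 1 + 1 by norm_num, contDiff_succ_iff_deriv]
    refine ⟨fun t => (G_d t).differentiableAt, by simp, ?_⟩
    rw [G_deriv]; exact g1_cd
  have G_high : ∀ t, T ≤ t → G t = 0 := by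
    intro t ht
    simp only [hG]
    rw [intervalIntegral.integral_congr (g := fun _ => 0)]
    · simp
    · intro s hs
      rw [uIcc_of_le ht] at hs
      exact g1_zero_high s hs.1
  have g1_bd : ∀ t, |g1 t| ≤ 2 ^ N / (2 * a ^ N) := by
    intro t
    rcases le_or_gt t ((a - δ) ^ 2) with ht | ht
    · rw [g1_zero_low t ht]; simp; positivity
    · have h1 : a - δ ≤ √t := Real.le_sqrt_of_sq_le ht.le
      have h2 : a / 2 ≤ √t := by linarith
      have h3 : (a / 2) ^ N ≤ (√t) ^ N := by gcongr
      simp only [hg1]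
      rw [abs_div, abs_of_pos (a := 2 * (√t) ^ N) (by
        have : 0 < √t := by linarith
        positivity)]
      calc |h √t| / (2 * √t ^ N) ≤ 1 / (2 * (a / 2) ^ N) := by
            gcongr
            exact hb _
        _ = 2 ^ N / (2 * a ^ N) := by
            rw [div_pow]; field_simp
  have G_bd : ∀ t, |G t| ≤ 2 ^ (N + 1) * δ * a / a ^ N := by
    have main : ∀ t, (a - δ) ^ 2 ≤ t → t ≤ T → |G t| ≤ 2 ^ (N + 1) * δ * a / a ^ N := by
      intro t ht1 ht2
      have := intervalIntegral.norm_integral_le_of_norm_le_const (f := g1) (a := T) (b := t)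
        (C := 2 ^ N / (2 * a ^ N)) (fun x _ => g1_bd x)
      rw [Real.norm_eq_abs] at this
      refine this.trans ?_
      have h4 : |t - T| ≤ 4 * a * δ := by
        rw [abs_sub_comm, abs_of_nonneg (by linarith)]
        rw [hT]; nlinarith
      calc 2 ^ N / (2 * a ^ N) * |t - T| ≤ 2 ^ N / (2 * a ^ N) * (4 * a * δ) := by gcongr
        _ = _ := by field_simp; ring
    intro t
    rcases le_or_gt T t with ht | ht
    · rw [G_high t ht]; simp; positivity
    · rcases le_or_gt ((a - δ) ^ 2) t with ht' | ht'
      · exact main t ht' ht.le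
      · have : G t = G ((a - δ) ^ 2) := by
          simp only [hG]
          rw [← intervalIntegral.integral_add_adjacent_intervals
            (g1_cont.intervalIntegrable T ((a - δ) ^ 2)) (g1_cont.intervalIntegrable _ t)]
          rw [intervalIntegral.integral_congr (g := fun _ => 0) (a := (a - δ) ^ 2)]
          · simp
          · intro s hs
            rw [uIcc_of_ge ht'.le] at hs
            exact g1_zero_low s hs.2
        rw [this]
        exact main _ le_rfl (by rw [hT]; nlinarith)
  have psi_zero : ∀ x : E N, a + δ ≤ ‖x‖ → G (‖x‖ ^ 2) = 0 := by
    intro x hx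
    apply G_high
    rw [hT]; gcongr
  have hcd : ContDiff ℝ 2 (fun x : E N => G (‖x‖ ^ 2)) := G_cd.comp (contDiff_norm_sq ℝ)
  have hcs : HasCompactSupport (fun x : E N => G (‖x‖ ^ 2)) := by
    apply HasCompactSupport.intro (isCompact_closedBall (0 : E N) (a + δ))
    intro x hx
    apply psi_zero
    simp at hx; exact hx.le
  refine ⟨fun x => G (‖x‖ ^ 2), hcd, hcs, ?_, ?_⟩
  · intro x
    rw [lapl_radial G_d g1_d]
    rcases lt_or_ge (‖x‖ ^ 2) ((a - δ) ^ 2) with ht | ht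
    · have e1 : deriv g1 (‖x‖ ^ 2) = 0 := by
        rw [(g1_low_ev _ ht).deriv_eq]; simp
      have hlt : ‖x‖ < a - δ := lt_of_pow_lt_pow_left₀ 2 had.le ht
      have e2 : h0 ‖x‖ = 0 := by
        have : h =ᶠ[𝓝 ‖x‖] fun _ => 0 := by
          filter_upwards [Iio_mem_nhds hlt] with s hs
          exact hz s (Or.inl (le_of_lt hs))
        rw [← (hd ‖x‖).deriv, this.deriv_eq]; simp
      rw [e1, e2, g1_zero_low _ ht.le]; simp
    · have hx2 : 0 < ‖x‖ ^ 2 := lt_of_lt_of_le (by positivity) ht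
      have hx : 0 < ‖x‖ := by
        by_contra hc
        have : ‖x‖ = 0 := le_antisymm (not_lt.1 hc) (norm_nonneg x)
        rw [this] at hx2; simp at hx2
      have hsq : √(‖x‖ ^ 2) = ‖x‖ := Real.sqrt_sq hx.le
      have ds : HasDerivAt (fun t : ℝ => √t) (1 / (2 * ‖x‖)) (‖x‖ ^ 2) := by
        have := Real.hasDerivAt_sqrt hx2.ne'
        rw [hsq] at this; exact this
      have dh : HasDerivAt (fun t : ℝ => h √t) (h0 ‖x‖ * (1 / (2 * ‖x‖))) (‖x‖ ^ 2) := by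
        have h1 : HasDerivAt h (h0 ‖x‖) (√(‖x‖ ^ 2)) := by rw [hsq]; exact hd _
        exact h1.comp (‖x‖ ^ 2) ds
      have dp := ((ds.pow N).const_mul 2)
      have dq := dh.div dp (by simp only [Pi.pow_apply, hsq]; positivity)
      have e1 := HasDerivAt.deriv (f := g1) dq
      rw [e1]
      simp only [hg1, Pi.pow_apply, hsq]
      obtain ⟨M, rfl⟩ : ∃ M, N = M + 1 := ⟨N - 1, by omega⟩
      simp only [Nat.add_sub_cancel]
      push_cast
      field_simp
      ring
  · have hmeas : MeasurableSet (Metric.ball (0 : E N) (a + δ)) := Metric.isOpen_ball.measurableSet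
    have e : (fun x : E N => G (‖x‖ ^ 2) ^ 2) =
        (Metric.ball (0 : E N) (a + δ)).indicator (fun x : E N => G (‖x‖ ^ 2) ^ 2) := by
      ext x
      by_cases hx : x ∈ Metric.ball (0 : E N) (a + δ)
      · rw [indicator_of_mem hx]
      · rw [indicator_of_notMem hx, psi_zero x (by simpa using hx)]; simp
    have hvol : volume.real (Metric.ball (0 : E N) (a + δ)) ≤
        (2 * a) ^ N * volume.real (Metric.ball (0 : E N) 1) := by
      rw [measureReal_def, Measure.addHaar_ball_of_pos _ _ (by linarith), ENNReal.toReal_mul,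
        ENNReal.toReal_ofReal (by positivity), ← measureReal_def]
      simp only [finrank_euclideanSpace, Fintype.card_fin]
      gcongr
      linarith
    rw [e, integral_indicator hmeas]
    have hfin : volume (Metric.ball (0 : E N) (a + δ)) ≠ ⊤ := measure_ball_lt_top.ne
    calc ∫ x in Metric.ball (0 : E N) (a + δ), G (‖x‖ ^ 2) ^ 2 
        ≤ ∫ x in Metric.ball (0 : E N) (a + δ), (2 ^ (N + 1) * δ * a / a ^ N) ^ 2 := by
          apply integral_mono_of_nonneg
          · exact Eventually.of_forall fun x => sq_nonneg _
          · exact integrableOn_const hfin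
          · refine Eventually.of_forall fun x => ?_
            exact sq_le_sq' (neg_le_of_abs_le (G_bd _)) (le_of_abs_le (G_bd _))
      _ = (2 ^ (N + 1) * δ * a / a ^ N) ^ 2 * volume.real (Metric.ball (0 : E N) (a + δ)) := by
          simp [mul_comm]
      _ ≤ _ := by gcongr

lemma nontrivial_E {N : ℕ} (hN : 5 ≤ N) : Nontrivial (E N) := by
  apply Module.nontrivial_of_finrank_pos (R := ℝ)
  simp; omega

lemma ae_norm_of_ae {N : ℕ} (hN : 5 ≤ N) {P : ℝ → Prop}
    (h : ∀ᵐ r ∂(volume.restrict (Ioi (0 : ℝ))), P r) : ∀ᵐ x : E N, P ‖x‖ := by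
  classical
  have := nontrivial_E hN
  set f : ℝ → ℝ := fun r => if P r then 0 else 1 with hf
  have h0 : (fun y : ℝ => y ^ (Module.finrank ℝ (E N) - 1) • f y) =ᵐ[volume.restrict (Ioi (0 : ℝ))]
      fun _ => 0 := by
    filter_upwards [h] with r hr
    simp [hf, hr]
  have hInt : Integrable (fun x : E N => f ‖x‖) volume := by
    rw [integrable_fun_norm_addHaar]
    exact (integrable_zero _ _ _).congr h0.symm
  have hz : ∫ x : E N, f ‖x‖ = 0 := by
    rw [integral_fun_norm_addHaar, integral_congr_ae h0]; simp
  rw [integral_eq_zero_iff_of_nonneg (fun x => by simp only [hf]; split_ifs <;> simp) hInt] at hz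
  filter_upwards [hz] with x hx
  by_contra hc
  simp [hf, hc] at hx

lemma exists_profile {N : ℕ} (hN : 5 ≤ N) {u : E N → ℝ} (hu : IsRadial u) :
    ∃ v : ℝ → ℝ, ∀ x, u x = v ‖x‖ := by
  refine ⟨fun r => u (EuclideanSpace.single ⟨0, by omega⟩ r), fun x => hu _ _ ?_⟩
  simp

/-- standard bump on the line -/
def bmp (ε : ℝ) (hε : 0 < ε) : ContDiffBump (0 : ℝ) := ⟨ε / 2, ε, by linarith, by linarith⟩

lemma bmp_supp {ε : ℝ} (hε : 0 < ε) {t : ℝ} (ht : ε ≤ |t|) : (bmp ε hε).normed volume t = 0 := by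
  by_contra h
  have : t ∈ Function.support ((bmp ε hε).normed volume) := h
  rw [ContDiffBump.support_normed_eq] at this
  simp [bmp] at this
  linarith

lemma bmp_le {ε : ℝ} (hε : 0 < ε) (t : ℝ) : (bmp ε hε).normed volume t ≤ 1 / ε := by
  have := (bmp ε hε).normed_le_div_measure_closedBall_rOut volume 2 (by simp [bmp]; linarith) t
  refine this.trans ?_
  simp [bmp, measureReal_def, Real.volume_closedBall]
  rw [ENNReal.toReal_ofReal hε.le]
  apply le_of_eq; field_simp

lemma exists_h {a ε δ : ℝ} (hε : 0 < ε) (hεδ : ε ≤ δ) (hδ : 0 < δ) :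
    ∃ h : ℝ → ℝ, ContDiff ℝ 1 h ∧ (∀ t, HasDerivAt h ((bmp ε hε).normed volume (t - a) -
      (bmp δ hδ).normed volume (t - a)) t) ∧
      (∀ t, t ≤ a - δ ∨ a + δ ≤ t → h t = 0) ∧ (∀ t, |h t| ≤ 1) := by
  set p : ℝ → ℝ := fun t => (bmp ε hε).normed volume (t - a) with hp
  set q : ℝ → ℝ := fun t => (bmp δ hδ).normed volume (t - a) with hq
  have pc : Continuous p := ((bmp ε hε).continuous_normed).comp (continuous_id.sub continuous_const)
  have qc : Continuous q := ((bmp δ hδ).continuous_normed).comp (continuous_id.sub continuous_const)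
  have pz : ∀ t, t ≤ a - δ ∨ a + δ ≤ t → p t = 0 := by
    intro t ht
    apply bmp_supp
    rcases ht with ht | ht
    · rw [abs_of_nonpos (by linarith)]; linarith
    · rw [abs_of_nonneg (by linarith)]; linarith
  have qz : ∀ t, t ≤ a - δ ∨ a + δ ≤ t → q t = 0 := by
    intro t ht
    apply bmp_supp
    rcases ht with ht | ht
    · rw [abs_of_nonpos (by linarith)]; linarith
    · rw [abs_of_nonneg (by linarith)]; linarith
  have pi : Integrable p := (bmp ε hε).integrable_normed.comp_sub_right a
  have qi : Integrable q := (bmp δ hδ).integrable_normed.comp_sub_right a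
  have p1 : ∫ t, p t = 1 := by
    rw [hp, integral_sub_right_eq_self (fun t => (bmp ε hε).normed volume t) a]
    exact (bmp ε hε).integral_normed
  have q1 : ∫ t, q t = 1 := by
    rw [hq, integral_sub_right_eq_self (fun t => (bmp δ hδ).normed volume t) a]
    exact (bmp δ hδ).integral_normed
  have p0 : ∀ t, 0 ≤ p t := fun t => (bmp ε hε).nonneg_normed _
  have q0 : ∀ t, 0 ≤ q t := fun t => (bmp δ hδ).nonneg_normed _
  have hD : ∀ t, HasDerivAt (fun t => ∫ s in (a - δ)..t, (p s - q s)) (p t - q t) t := fun t =>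
    ((pc.sub qc).integral_hasStrictDerivAt (a - δ) t).hasDerivAt
  have zlow : ∀ t, t ≤ a - δ → ∫ s in (a - δ)..t, (p s - q s) = 0 := by
    intro t ht
    rw [intervalIntegral.integral_congr (g := fun _ => 0)]
    · simp
    · intro s hs
      rw [uIcc_of_ge ht] at hs
      simp [pz s (Or.inl hs.2), qz s (Or.inl hs.2)]
  refine ⟨fun t => ∫ s in (a - δ)..t, (p s - q s), ?_, hD, ?_, ?_⟩
  · rw [contDiff_one_iff_deriv]
    refine ⟨fun t => (hD t).differentiableAt, ?_⟩
    have : deriv (fun t => ∫ s in (a - δ)..t, (p s - q s)) = fun t => p t - q t :=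
      funext fun t => (hD t).deriv
    rw [this]; exact pc.sub qc
  · intro t ht
    rcases ht with ht | ht
    · exact zlow t ht
    · show ∫ s in (a - δ)..t, (p s - q s) = 0
      rw [intervalIntegral.integral_eq_integral_of_support_subset]
      · rw [integral_sub pi qi, p1, q1]; simp
      · intro s hs
        by_contra hc
        apply hs
        have : s ≤ a - δ ∨ a + δ ≤ s := by
          by_contra hcc
          push Not at hcc
          exact hc ⟨hcc.1, by linarith⟩
        simp [pz s this, qz s this]
  · intro t
    rcases le_total t (a - δ) with ht | ht
    · show |∫ s in (a - δ)..t, (p s - q s)| ≤ 1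
      rw [zlow t ht]; simp
    · show |∫ s in (a - δ)..t, (p s - q s)| ≤ 1
      rw [intervalIntegral.integral_sub (pc.intervalIntegrable _ _) (qc.intervalIntegrable _ _)]
      have aux : ∀ f : ℝ → ℝ, Integrable f → (∀ t, 0 ≤ f t) → ∫ t, f t = 1 →
          0 ≤ ∫ s in (a - δ)..t, f s ∧ ∫ s in (a - δ)..t, f s ≤ 1 := by
        intro f fi f0 f1
        refine ⟨intervalIntegral.integral_nonneg ht fun s _ => f0 s, ?_⟩
        rw [intervalIntegral.integral_of_le ht, ← f1]
        exact setIntegral_le_integral fi (Eventually.of_forall f0)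
      have A := aux p pi p0 p1
      have B := aux q qi q0 q1
      rw [abs_le]; constructor <;> linarith

lemma loc_int {N : ℕ} (hN : 5 ≤ N) {u : E N → ℝ} {v : ℝ → ℝ} (hu : MemLp u (twoSS N) volume)
    (huv : ∀ x, u x = v ‖x‖) : LocallyIntegrable ((Ioi (1/4 : ℝ)).indicator v) := by
  have := nontrivial_E hN
  have main : ∀ R : ℝ, IntegrableOn v (Ioi (1/4 : ℝ) ∩ Iio R) := by
    intro R
    have h1 : IntegrableOn (fun x : E N => v ‖x‖) (Metric.ball 0 R) := by
      have : IsFiniteMeasure (volume.restrict (Metric.ball (0 : E N) R)) :=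
        ⟨by simpa using measure_ball_lt_top⟩
      have : (fun x : E N => v ‖x‖) = u := funext fun x => (huv x).symm
      rw [this]
      exact (hu.restrict _).integrable (one_le_twoSS hN)
    rw [integrableOn_fun_norm_addHaar] at h1
    have h2 : IntegrableOn (fun y : ℝ => y ^ (Module.finrank ℝ (E N) - 1) • v y)
      (Ioi (1/4 : ℝ) ∩ Iio R) := h1.mono_set (fun y hy => ⟨by
        have := hy.1; simp only [mem_Ioi] at this; linarith, hy.2⟩)
    have hm : MeasurableSet (Ioi (1/4 : ℝ) ∩ Iio R) := measurableSet_Ioi.inter measurableSet_Iio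
    set k := Module.finrank ℝ (E N) - 1
    have h3 : IntegrableOn (fun y : ℝ => (y ^ k)⁻¹ * (y ^ k • v y)) (Ioi (1/4 : ℝ) ∩ Iio R) := by
      refine Integrable.bdd_mul (c := ((1/4 : ℝ) ^ k)⁻¹) h2 ?_ ?_
      · exact (by fun_prop : Measurable fun y : ℝ => (y ^ k)⁻¹).aestronglyMeasurable
      · filter_upwards [ae_restrict_mem hm] with y hy
        have hy1 : (1/4 : ℝ) < y := hy.1
        rw [Real.norm_eq_abs, abs_of_nonneg (by positivity)]
        gcongr
    refine h3.congr_fun ?_ hm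
    intro y hy
    have hy1 : (1/4 : ℝ) < y := hy.1
    have : y ^ k ≠ 0 := by positivity
    simp only [smul_eq_mul]
    field_simp
  rw [locallyIntegrable_iff]
  intro k hk
  obtain ⟨R, hR⟩ := hk.bddAbove
  have : IntegrableOn ((Ioi (1/4 : ℝ)).indicator v) (Iio (R + 1)) := by
    unfold IntegrableOn
    rw [integrable_indicator_iff measurableSet_Ioi]
    unfold IntegrableOn
    rw [Measure.restrict_restrict measurableSet_Ioi]
    exact main _
  exact this.mono_set fun y hy => by
    have := hR hy
    simp only [mem_Iio]; linarith

lemma integral_sq_le_one {N : ℕ} {w : E N → ℝ} (hw : MemLp w 2 volume)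
    (h1 : ∫⁻ x, ENNReal.ofReal ((w x) ^ 2) ≤ 1) :
    Integrable (fun x => (w x) ^ 2) ∧ ∫ x, (w x) ^ 2 ≤ 1 := by
  refine ⟨hw.integrable_sq, ?_⟩
  rw [integral_eq_lintegral_of_nonneg_ae (Eventually.of_forall fun x => sq_nonneg _)
    hw.integrable_sq.1]
  exact ENNReal.toReal_le_of_le_ofReal zero_le_one (by simpa using h1)

/-- constant in the pointwise estimate -/
def Ckey (N : ℕ) : ℝ :=
  (1 + 2 ^ (3 * N + 2) * volume.real (Metric.ball (0 : E N) 1)) /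
    (N * volume.real (Metric.ball (0 : E N) 1))

lemma vol_pos (N : ℕ) : 0 < volume.real (Metric.ball (0 : E N) 1) :=
  ENNReal.toReal_pos (Metric.measure_ball_pos _ _ one_pos).ne' measure_ball_lt_top.ne

lemma Ckey_pos {N : ℕ} (hN : 5 ≤ N) : 0 < Ckey N := by
  have := vol_pos N
  have : (0 : ℝ) < N := by exact_mod_cast (by omega : 0 < N)
  unfold Ckey
  positivity

lemma test_bound {N : ℕ} (hN : 5 ≤ N) {u w : E N → ℝ} {v : ℝ → ℝ} (hm : MemD22 N u w)
    (huv : ∀ x, u x = v ‖x‖) (h1 : ∫⁻ x, ENNReal.ofReal ((w x) ^ 2) ≤ 1)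
    {h h0 : ℝ → ℝ} {a δ : ℝ} (hδ : 0 < δ) (hδa : δ ≤ a / 2)
    (hh : ContDiff ℝ 1 h) (hd : ∀ t, HasDerivAt h (h0 t) t)
    (hz : ∀ t, t ≤ a - δ ∨ a + δ ≤ t → h t = 0) (hb : ∀ t, |h t| ≤ 1) :
    |∫ r in Ioi (0 : ℝ), v r * h0 r| ≤ Ckey N * (δ * a ^ (1 - N / 2 : ℝ)) := by
  have := nontrivial_E hN
  have ha : 0 < a := by linarith
  obtain ⟨ψ, ψ1, ψ2, ψ3, ψ4⟩ := exists_test hN hδ hδa hh hd hz hb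
  obtain ⟨-, i2, i3⟩ := test_identity hN hm ψ1 ψ2
  obtain ⟨wi, wle⟩ := integral_sq_le_one hm.2.1 h1
  set om := volume.real (Metric.ball (0 : E N) 1) with hom
  have omp : 0 < om := vol_pos N
  set l := δ * a ^ (1 - N / 2 : ℝ) with hl
  have lp : 0 < l := by positivity
  have hNp : (0 : ℝ) < N := by exact_mod_cast (by omega : 0 < N)
  have lsq : l ^ 2 = δ ^ 2 * (a ^ 2 / a ^ N) := by
    rw [hl, mul_pow, ← Real.rpow_natCast (a ^ (1 - N / 2 : ℝ)) 2, ← Real.rpow_mul ha.le]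
    rw [show (1 - (N : ℝ) / 2) * ((2 : ℕ) : ℝ) = ((2 : ℕ) : ℝ) - (N : ℝ) by push_cast; ring,
      Real.rpow_sub ha, Real.rpow_natCast, Real.rpow_natCast]
  have ψle : ∫ x, (ψ x) ^ 2 ≤ 2 ^ (3 * N + 2) * om * l ^ 2 := by
    refine ψ4.trans (le_of_eq ?_)
    rw [lsq]
    rw [mul_pow 2 a N, show 3 * N + 2 = (N + 1) + (N + 1) + N by ring, pow_add, pow_add]
    field_simp
    ring
  have ψi : Integrable (fun x => (ψ x) ^ 2) :=
    (ψ1.continuous.memLp_of_hasCompactSupport (p := 2) ψ2).integrable_sq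
  have polar : ∫ x, u x * lapl ψ x = N * om * ∫ r in Ioi (0 : ℝ), v r * h0 r := by
    have e1 : ∀ x, u x * lapl ψ x = (fun r => v r * (h0 r / r ^ (N - 1))) ‖x‖ := by
      intro x; rw [huv, ψ3]
    simp_rw [e1]
    rw [integral_fun_norm_addHaar volume (fun r => v r * (h0 r / r ^ (N - 1)))]
    simp only [finrank_euclideanSpace, Fintype.card_fin, nsmul_eq_mul, smul_eq_mul]
    rw [← hom, mul_assoc]
    congr 2
    apply setIntegral_congr_fun measurableSet_Ioi
    intro r hr
    have hr' : (0 : ℝ) < r := hr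
    simp only
    field_simp
  have bound : |∫ x, w x * ψ x| ≤ (1 + 2 ^ (3 * N + 2) * om) * l := by
    have step : ∀ x, ‖w x * ψ x‖ ≤ l * (w x) ^ 2 + l⁻¹ * (ψ x) ^ 2 := by
      intro x
      rw [Real.norm_eq_abs, abs_mul]
      have hs : 0 ≤ (l * |w x| - |ψ x|) ^ 2 := sq_nonneg _
      have e : l * (w x) ^ 2 + l⁻¹ * (ψ x) ^ 2 - |w x| * |ψ x| =
          l⁻¹ * ((l * |w x| - |ψ x|) ^ 2 + l * |w x| * |ψ x|) := by
        rw [← sq_abs (w x), ← sq_abs (ψ x)]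
        field_simp
        ring
      have : 0 ≤ l⁻¹ * ((l * |w x| - |ψ x|) ^ 2 + l * |w x| * |ψ x|) := by positivity
      linarith
    have h2 := norm_integral_le_of_norm_le ((wi.const_mul l).add (ψi.const_mul l⁻¹))
      (Eventually.of_forall step)
    rw [Real.norm_eq_abs] at h2
    refine h2.trans ?_
    simp only [Pi.add_apply]
    rw [integral_add (wi.const_mul l) (ψi.const_mul l⁻¹), integral_const_mul, integral_const_mul]
    calc (l * ∫ x, (w x) ^ 2) + l⁻¹ * ∫ x, (ψ x) ^ 2 
        ≤ l * 1 + l⁻¹ * (2 ^ (3 * N + 2) * om * l ^ 2) := by gcongr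
      _ = (1 + 2 ^ (3 * N + 2) * om) * l := by field_simp
  rw [← i3, polar, abs_mul, abs_of_pos (by positivity : 0 < N * om)] at bound
  unfold Ckey
  rw [← hom, div_mul_eq_mul_div, le_div_iff₀ (by positivity), mul_comm]
  exact bound

lemma key_pointwise {N : ℕ} (hN : 5 ≤ N) {u w : E N → ℝ} {v : ℝ → ℝ} (hm : MemD22 N u w)
    (huv : ∀ x, u x = v ‖x‖) (h1 : ∫⁻ x, ENNReal.ofReal ((w x) ^ 2) ≤ 1) :
    ∀ᵐ a : ℝ, 1 ≤ a → ∀ δ, 0 < δ → δ ≤ a / 2 →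
      IntegrableOn v (Icc (a - δ) (a + δ)) ∧
      |v a| ≤ (1 / δ) * (∫ r in Icc (a - δ) (a + δ), |v r|) + Ckey N * (δ * a ^ (1 - N / 2 : ℝ)) := by
  have hli := loc_int hN hm.1 huv
  set g := (Ioi (1/4 : ℝ)).indicator v with hg
  have hlim := ContDiffBump.ae_convolution_tendsto_right_of_locallyIntegrable (μ := volume) (K := 2)
    (φ := fun n : ℕ => bmp (1 / ((n : ℝ) + 1)) (by positivity)) (l := atTop) (g := g)
    (by simpa [bmp] using tendsto_one_div_add_atTop_nhds_zero_nat (𝕜 := ℝ))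
    (Eventually.of_forall fun n => by simp [bmp]; linarith) hli
  filter_upwards [hlim] with a hla ha1 δ hδ hδa
  have ha : 0 < a := by linarith
  have hsub : Icc (a - δ) (a + δ) ⊆ Ioi (1/4 : ℝ) := fun r hr => by
    simp only [mem_Ioi]; linarith [hr.1]
  have hgv : ∀ r ∈ Icc (a - δ) (a + δ), g r = v r := fun r hr => indicator_of_mem (hsub hr) _
  have gi : IntegrableOn g (Icc (a - δ) (a + δ)) := hli.integrableOn_isCompact isCompact_Icc
  have vi : IntegrableOn v (Icc (a - δ) (a + δ)) := gi.congr_fun hgv measurableSet_Icc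
  refine ⟨vi, ?_⟩
  have J : ∀ ε (hε : 0 < ε), ε ≤ δ →
      IntegrableOn (fun r => v r * (bmp ε hε).normed volume (r - a)) (Ioi 0) ∧
      convolution ((bmp ε hε).normed volume) g (ContinuousLinearMap.lsmul ℝ ℝ) volume a = 
        ∫ r in Ioi (0 : ℝ), v r * (bmp ε hε).normed volume (r - a) ∧ 
      ∫ r in Ioi (0 : ℝ), v r * (bmp ε hε).normed volume (r - a) =
        ∫ r in Icc (a - δ) (a + δ), v r * (bmp ε hε).normed volume (r - a) := by
    intro ε hε hεδ
    have hzero : ∀ r, r ∉ Icc (a - δ) (a + δ) → (bmp ε hε).normed volume (r - a) = 0 := by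
      intro r hr
      apply bmp_supp
      by_contra hc
      push Not at hc
      have := abs_lt.1 hc
      exact hr ⟨by linarith, by linarith⟩
    have e1 : (fun r => v r * (bmp ε hε).normed volume (r - a)) = 
        (Icc (a - δ) (a + δ)).indicator (fun r => v r * (bmp ε hε).normed volume (r - a)) := by
      ext r
      by_cases hr : r ∈ Icc (a - δ) (a + δ)
      · rw [indicator_of_mem hr]
      · rw [indicator_of_notMem hr, hzero r hr, mul_zero]
    have i1 : IntegrableOn (fun r => v r * (bmp ε hε).normed volume (r - a))
        (Icc (a - δ) (a + δ)) := by
      apply vi.mul_continuousOn _ isCompact_Icc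
      exact ((bmp ε hε).continuous_normed.comp (continuous_id.sub continuous_const)).continuousOn
    have i2 : Integrable (fun r => v r * (bmp ε hε).normed volume (r - a)) := by
      rw [e1, integrable_indicator_iff measurableSet_Icc]; exact i1
    have hs0 : Icc (a - δ) (a + δ) ⊆ Ioi (0 : ℝ) := fun r hr => by
      simp only [mem_Ioi]; linarith [hr.1]
    have e2 : ∫ r in Ioi (0 : ℝ), v r * (bmp ε hε).normed volume (r - a) =
        ∫ r in Icc (a - δ) (a + δ), v r * (bmp ε hε).normed volume (r - a) := by
      rw [e1, setIntegral_indicator measurableSet_Icc, inter_eq_self_of_subset_right hs0]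
      exact setIntegral_congr_fun measurableSet_Icc fun r hr => (congrFun e1 r)
    refine ⟨i2.integrableOn, ?_, e2⟩
    rw [e2, convolution_eq_swap, ← integral_indicator measurableSet_Icc, ← e1]
    congr 1
    ext r
    simp only [ContinuousLinearMap.lsmul_apply, smul_eq_mul]
    rw [show a - r = -(r - a) by ring, ContDiffBump.normed_neg, mul_comm]
    by_cases hr : r ∈ Icc (a - δ) (a + δ)
    · rw [hgv r hr]
    · rw [hzero r hr]; simp
  obtain ⟨j1, -, j3⟩ := J δ hδ le_rfl
  set Id := ∫ r in Ioi (0 : ℝ), v r * (bmp δ hδ).normed volume (r - a) with hId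
  have Idb : |Id| ≤ (1 / δ) * ∫ r in Icc (a - δ) (a + δ), |v r| := by
    rw [j3, ← integral_const_mul, ← Real.norm_eq_abs]
    apply norm_integral_le_of_norm_le (vi.abs.const_mul _)
    refine Eventually.of_forall fun r => ?_
    rw [Real.norm_eq_abs, abs_mul, mul_comm, abs_of_nonneg ((bmp δ hδ).nonneg_normed _)]
    gcongr
    exact bmp_le hδ _
  have hga : g a = v a := hgv a ⟨by linarith, by linarith⟩
  rw [hga] at hla
  have ev : ∀ᶠ n : ℕ in atTop, |convolution ((bmp (1 / ((n : ℝ) + 1)) (by positivity)).normed volume) g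
      (ContinuousLinearMap.lsmul ℝ ℝ) volume a| ≤ 
      (1 / δ) * (∫ r in Icc (a - δ) (a + δ), |v r|) + Ckey N * (δ * a ^ (1 - N / 2 : ℝ)) := by
    have t0 := tendsto_one_div_add_atTop_nhds_zero_nat (𝕜 := ℝ)
    filter_upwards [t0.eventually (gt_mem_nhds hδ)] with n hn
    have hε : 0 < 1 / ((n : ℝ) + 1) := by positivity
    obtain ⟨k1, k2, -⟩ := J _ hε hn.le
    rw [k2]
    obtain ⟨h, c1, c2, c3, c4⟩ := exists_h (a := a) hε hn.le hδ
    have tb := test_bound hN hm huv h1 hδ hδa c1 c2 c3 c4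
    simp only [mul_sub] at tb
    rw [integral_sub k1 j1, ← hId] at tb
    have := abs_sub_abs_le_abs_sub (∫ r in Ioi (0 : ℝ), v r * (bmp (1 / ((n : ℝ) + 1)) hε).normed volume (r - a)) Id
    linarith
  exact le_of_tendsto hla.abs ev

lemma ae_norm_tail {N : ℕ} (hN : 5 ≤ N) {R2 : ℝ} {P : ℝ → Prop}
    (h : ∀ᵐ r ∂(volume.restrict (Ioi R2)), P r) : ∀ᵐ x : E N, R2 < ‖x‖ → P ‖x‖ := by
  rw [ae_restrict_iff' measurableSet_Ioi] at h
  exact ae_norm_of_ae hN (P := fun r => R2 < r → P r) (ae_restrict_of_ae h)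

lemma rpow_le_shell {a r γ : ℝ} (ha : 0 < a) (h1 : a / 2 ≤ r) (h2 : r ≤ 2 * a) :
    r ^ γ ≤ 2 ^ |γ| * a ^ γ := by
  have hr : 0 < r := by linarith
  rcases le_total 0 γ with hγ | hγ
  · rw [abs_of_nonneg hγ, ← Real.mul_rpow (by norm_num) ha.le]
    exact Real.rpow_le_rpow hr.le h2 hγ
  · rw [abs_of_nonpos hγ]
    have : r ^ γ ≤ (a / 2) ^ γ := Real.rpow_le_rpow_of_nonpos (by positivity) h1 hγ
    refine this.trans (le_of_eq ?_)
    rw [Real.div_rpow ha.le (by norm_num), Real.rpow_neg (by norm_num)]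
    field_simp

/-- constant for the local L² bound -/
def Dloc (N : ℕ) (γ c0 : ℝ) : ℝ :=
  (c0⁻¹ * 2 ^ |γ|) * 2 ^ (N - 1) / (N * volume.real (Metric.ball (0 : E N) 1))

lemma Dloc_nonneg {N : ℕ} {γ c0 : ℝ} (hc : 0 < c0) : 0 ≤ Dloc N γ c0 := by
  unfold Dloc; positivity

lemma local_L2 {N : ℕ} (hN : 5 ≤ N) {V : ℝ → ℝ≥0∞} {u : E N → ℝ} {v : ℝ → ℝ}
    (hum : AEStronglyMeasurable u volume)
    (huv : ∀ x, u x = v ‖x‖) {R2 γ c0 : ℝ} (hc : 0 < c0)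
    (hVl : ∀ᵐ r ∂(volume.restrict (Ioi R2)), ENNReal.ofReal (c0 * r ^ (-γ)) ≤ V r)
    (hVu : ∫⁻ x : E N, V ‖x‖ * ENNReal.ofReal ((u x) ^ 2) ≤ 1)
    {a δ : ℝ} (haR : 2 * R2 < a) (hδ : 0 < δ) (hδa : δ ≤ a / 2)
    (vi : IntegrableOn v (Icc (a - δ) (a + δ))) :
    IntegrableOn (fun r => (v r) ^ 2) (Icc (a - δ) (a + δ)) ∧
    ∫ r in Icc (a - δ) (a + δ), (v r) ^ 2 ≤ Dloc N γ c0 * (a ^ γ / a ^ (N - 1)) := by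
  have := nontrivial_E hN
  have ha : 0 < a := by linarith
  set S := Icc (a - δ) (a + δ) with hS
  have hSm : MeasurableSet S := measurableSet_Icc
  set f : ℝ → ℝ := S.indicator (fun r => (v r) ^ 2) with hf
  have hNp : (0 : ℝ) < N := by exact_mod_cast (by omega : 0 < N)
  set om := volume.real (Metric.ball (0 : E N) 1) with hom
  have omp : 0 < om := vol_pos N
  have f0 : ∀ r, 0 ≤ f r := fun r => indicator_nonneg (fun _ _ => sq_nonneg _) r
  have fm : AEStronglyMeasurable (fun x : E N => f ‖x‖) volume := by
    have e : (fun x : E N => f ‖x‖) = ((fun x : E N => ‖x‖) ⁻¹' S).indicator (fun x => (u x) ^ 2) := by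
      ext x
      by_cases hx : ‖x‖ ∈ S
      · simp [hf, hx, huv]
      · simp [hf, hx]
    rw [e]
    exact (hum.pow 2).indicator (measurable_norm hSm)
  set M := c0⁻¹ * 2 ^ |γ| * a ^ γ with hM
  have M0 : 0 ≤ M := by positivity
  have hle : ∫⁻ x : E N, ENNReal.ofReal (f ‖x‖) ≤ ENNReal.ofReal M := by
    calc ∫⁻ x : E N, ENNReal.ofReal (f ‖x‖) 
        ≤ ∫⁻ x : E N, ENNReal.ofReal M * (V ‖x‖ * ENNReal.ofReal ((u x) ^ 2)) := by
          apply lintegral_mono_ae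
          filter_upwards [ae_norm_tail hN hVl] with x hx
          by_cases hxS : ‖x‖ ∈ S
          · have x1 : a / 2 ≤ ‖x‖ := by linarith [hxS.1]
            have x2 : ‖x‖ ≤ 2 * a := by linarith [hxS.2]
            have x0 : 0 < ‖x‖ := by linarith
            have hx' := hx (by linarith)
            simp only [hf, indicator_of_mem hxS]
            rw [huv x, ← mul_assoc]
            have : 1 ≤ ENNReal.ofReal M * V ‖x‖ := by
              calc 1 ≤ ENNReal.ofReal (M * (c0 * ‖x‖ ^ (-γ))) := by
                    rw [ENNReal.one_le_ofReal]
                    have := rpow_le_shell (γ := γ) ha x1 x2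
                    have h3 : 0 < ‖x‖ ^ γ := by positivity
                    rw [Real.rpow_neg x0.le, hM]
                    have e : c0⁻¹ * 2 ^ |γ| * a ^ γ * (c0 * (‖x‖ ^ γ)⁻¹) =
                      (2 ^ |γ| * a ^ γ) / ‖x‖ ^ γ := by field_simp
                    rw [e, le_div_iff₀ h3]; linarith
                _ = ENNReal.ofReal M * ENNReal.ofReal (c0 * ‖x‖ ^ (-γ)) := ENNReal.ofReal_mul M0
                _ ≤ _ := by gcongr
            calc ENNReal.ofReal ((v ‖x‖) ^ 2) = 1 * ENNReal.ofReal ((v ‖x‖) ^ 2) := by simp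
              _ ≤ _ := by gcongr
          · simp [hf, indicator_of_notMem hxS]
      _ = ENNReal.ofReal M * ∫⁻ x : E N, (V ‖x‖ * ENNReal.ofReal ((u x) ^ 2)) := by
          rw [lintegral_const_mul' _ _ ENNReal.ofReal_ne_top]
      _ ≤ ENNReal.ofReal M * 1 := by gcongr
      _ = _ := by simp
  have fi : Integrable (fun x : E N => f ‖x‖) volume := by
    refine ⟨fm, ?_⟩
    rw [hasFiniteIntegral_iff_ofReal (Eventually.of_forall fun x => f0 _)]
    exact hle.trans_lt ENNReal.ofReal_lt_top
  have fle : ∫ x : E N, f ‖x‖ ≤ M := by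
    rw [integral_eq_lintegral_of_nonneg_ae (Eventually.of_forall fun x => f0 _) fm]
    exact ENNReal.toReal_le_of_le_ofReal M0 hle
  rw [integral_fun_norm_addHaar] at fle
  rw [integrable_fun_norm_addHaar] at fi
  simp only [finrank_euclideanSpace, Fintype.card_fin, nsmul_eq_mul, smul_eq_mul] at fle fi
  have hs0 : S ⊆ Ioi (0 : ℝ) := fun r hr => by
    simp only [mem_Ioi]; linarith [hr.1]
  have e1 : ∀ r, r ^ (N - 1) * f r = S.indicator (fun r => r ^ (N - 1) * (v r) ^ 2) r := by
    intro r
    by_cases hr : r ∈ S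
    · simp [hf, indicator_of_mem hr]
    · simp [hf, indicator_of_notMem hr]
  simp only [e1] at fle fi
  rw [setIntegral_indicator hSm, inter_eq_self_of_subset_right hs0, ← hom] at fle
  have fi2 : IntegrableOn (fun r => r ^ (N - 1) * (v r) ^ 2) S := by
    unfold IntegrableOn at fi
    rw [integrable_indicator_iff hSm] at fi
    unfold IntegrableOn at fi
    rwa [Measure.restrict_restrict hSm, inter_eq_self_of_subset_left hs0] at fi
  have cmp : ∀ r ∈ S, (a / 2) ^ (N - 1) * (v r) ^ 2 ≤ r ^ (N - 1) * (v r) ^ 2 := by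
    intro r hr
    have : a / 2 ≤ r := by linarith [hr.1]
    gcongr
  have i3 : IntegrableOn (fun r => (a / 2) ^ (N - 1) * (v r) ^ 2) S := by
    refine Integrable.mono' fi2 ?_ ?_
    · exact (vi.1.pow 2).const_mul _
    · filter_upwards [ae_restrict_mem hSm] with r hr
      rw [Real.norm_eq_abs, abs_of_nonneg (by positivity)]
      exact cmp r hr
  have hap : 0 < (a / 2) ^ (N - 1) := by positivity
  have i4 : IntegrableOn (fun r => (v r) ^ 2) S := by
    have := i3.const_mul ((a / 2) ^ (N - 1))⁻¹
    refine this.congr (Eventually.of_forall fun r => ?_)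
    simp only
    field_simp
  refine ⟨i4, ?_⟩
  have h5 : (a / 2) ^ (N - 1) * ∫ r in S, (v r) ^ 2 ≤ ∫ r in S, r ^ (N - 1) * (v r) ^ 2 := by
    rw [← integral_const_mul]
    exact setIntegral_mono_on i3 fi2 hSm cmp
  have h6 : N * (om * ((a / 2) ^ (N - 1) * ∫ r in S, (v r) ^ 2)) ≤ M := 
    le_trans (by gcongr) fle
  have e7 : Dloc N γ c0 * (a ^ γ / a ^ (N - 1)) = M / (N * om * (a / 2) ^ (N - 1)) := by
    unfold Dloc
    rw [← hom, hM, div_pow]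
    field_simp
  rw [e7, le_div_iff₀ (by positivity)]
  calc (∫ r in S, (v r) ^ 2) * (N * om * (a / 2) ^ (N - 1)) = 
      N * (om * ((a / 2) ^ (N - 1) * ∫ r in S, (v r) ^ 2)) := by ring
    _ ≤ M := h6

lemma decay {N : ℕ} (hN : 5 ≤ N) {V : ℝ → ℝ≥0∞} {u w : E N → ℝ} (hm : MemD22 N u w)
    (hur : IsRadial u) (h1 : ∫⁻ x, ENNReal.ofReal ((w x) ^ 2) ≤ 1)
    {R2 γ c0 : ℝ} (hc : 0 < c0) (hγ : γ ≤ 4)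
    (hVl : ∀ᵐ r ∂(volume.restrict (Ioi R2)), ENNReal.ofReal (c0 * r ^ (-γ)) ≤ V r)
    (hVu : ∫⁻ x : E N, V ‖x‖ * ENNReal.ofReal ((u x) ^ 2) ≤ 1) :
    ∀ᵐ x : E N, 1 ≤ ‖x‖ → 2 * R2 < ‖x‖ →
      |u x| ≤ (2 + 2 * Dloc N γ c0 + Ckey N) * ‖x‖ ^ (-(N / 2 - 1 - γ / 4) : ℝ) := by
  obtain ⟨v, huv⟩ := exists_profile hN hur
  have kp := ae_norm_of_ae hN (ae_restrict_of_ae (key_pointwise hN hm huv h1))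
  filter_upwards [kp] with x hx x1 xR
  set a := ‖x‖ with hadef
  have ha : 0 < a := by linarith
  set δ := a ^ (γ / 4) / 2 with hδdef
  have hδ : 0 < δ := by positivity
  have hδa : δ ≤ a / 2 := by
    have : a ^ (γ / 4) ≤ a ^ (1 : ℝ) := Real.rpow_le_rpow_of_exponent_le x1 (by linarith)
    rw [Real.rpow_one] at this
    rw [hδdef]; linarith
  obtain ⟨vi, hva⟩ := hx x1 δ hδ hδa
  obtain ⟨v2i, hv2⟩ := local_L2 hN hm.1.1 huv hc hVl hVu xR hδ hδa vi
  rw [huv x]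
  set ν : ℝ := N / 2 - 1 - γ / 4 with hν
  set l := a ^ (-ν) with hl
  have lp : 0 < l := by positivity
  have hNc : ((N - 1 : ℕ) : ℝ) = (N : ℝ) - 1 := by
    rw [Nat.cast_sub (by omega)]; simp
  have D0 := Dloc_nonneg (N := N) (γ := γ) hc
  have step1 : ∫ r in Icc (a - δ) (a + δ), |v r| ≤
      l * (2 * δ) + l⁻¹ * (Dloc N γ c0 * (a ^ γ / a ^ (N - 1))) := by
    calc ∫ r in Icc (a - δ) (a + δ), |v r| ≤ ∫ r in Icc (a - δ) (a + δ), (l + l⁻¹ * (v r) ^ 2) := by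
          apply integral_mono_of_nonneg
          · exact Eventually.of_forall fun r => abs_nonneg _
          · exact Integrable.add (integrableOn_const (by simp)) (v2i.const_mul _)
          · refine Eventually.of_forall fun r => ?_
            have e : l + l⁻¹ * (v r) ^ 2 - |v r| = l⁻¹ * ((l - |v r|) ^ 2 + l * |v r|) := by
              rw [← sq_abs (v r)]; field_simp; ring
            have : 0 ≤ l⁻¹ * ((l - |v r|) ^ 2 + l * |v r|) := by positivity
            show |v r| ≤ l + l⁻¹ * (v r) ^ 2
            linarith
      _ = l * (2 * δ) + l⁻¹ * ∫ r in Icc (a - δ) (a + δ), (v r) ^ 2 := by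
          have ic : Integrable (fun _ : ℝ => l) (volume.restrict (Icc (a - δ) (a + δ))) :=
            integrableOn_const (by simp)
          rw [integral_add ic (v2i.const_mul _), integral_const_mul]
          congr 1
          simp [measureReal_def]
          rw [ENNReal.toReal_ofReal (by linarith)]
          ring
      _ ≤ _ := by gcongr
  have step2 : δ⁻¹ * (l⁻¹ * (a ^ γ / a ^ (N - 1))) ≤ 2 * l := by
    have e : δ⁻¹ * (l⁻¹ * (a ^ γ / a ^ (N - 1))) = 2 * a ^ (-(γ / 4) + ν + (γ - ((N : ℝ) - 1))) := by
      rw [Real.rpow_add ha, Real.rpow_add ha, Real.rpow_sub ha γ, ← hNc, Real.rpow_natCast,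
        Real.rpow_neg ha.le, hδdef, hl, Real.rpow_neg ha.le ν]
      field_simp
    rw [e]
    have : a ^ (-(γ / 4) + ν + (γ - ((N : ℝ) - 1))) ≤ l := by
      rw [hl]
      apply Real.rpow_le_rpow_of_exponent_le x1
      rw [hν]; linarith
    linarith
  have step3 : δ * a ^ (1 - N / 2 : ℝ) ≤ l := by
    have e : δ * a ^ (1 - N / 2 : ℝ) = l / 2 := by
      rw [hl, hν, show (-((N : ℝ) / 2 - 1 - γ / 4)) = γ / 4 + (1 - N / 2) by ring,
        Real.rpow_add ha, hδdef]
      ring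
    rw [e]; linarith
  have C0 := Ckey_pos hN
  calc |v a| ≤ (1 / δ) * (∫ r in Icc (a - δ) (a + δ), |v r|) + Ckey N * (δ * a ^ (1 - N / 2 : ℝ)) := hva
    _ ≤ (1 / δ) * (l * (2 * δ) + l⁻¹ * (Dloc N γ c0 * (a ^ γ / a ^ (N - 1)))) + Ckey N * l := by
        gcongr
    _ = 2 * l + Dloc N γ c0 * (δ⁻¹ * (l⁻¹ * (a ^ γ / a ^ (N - 1)))) + Ckey N * l := by
        field_simp
    _ ≤ 2 * l + Dloc N γ c0 * (2 * l) + Ckey N * l := by gcongr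
    _ = _ := by ring

lemma vpow_le {c0 γ r v t p : ℝ} (hc : 0 < c0) (hr : 0 < r) (hv : c0 * r ^ (-γ) ≤ v)
    (ht : t ≤ p) : v ^ t ≤ v ^ p * (c0 ^ (-(p - t)) * r ^ (γ * (p - t))) := by
  have h0 : 0 < c0 * r ^ (-γ) := by positivity
  have v0 : 0 < v := lt_of_lt_of_le h0 hv
  have e1 : v ^ t = v ^ p * v ^ (-(p - t)) := by
    rw [← Real.rpow_add v0]; congr 1; ring
  have e2 : c0 ^ (-(p - t)) * r ^ (γ * (p - t)) = (c0 * r ^ (-γ)) ^ (-(p - t)) := by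
    rw [Real.mul_rpow hc.le (by positivity), ← Real.rpow_mul hr.le]; congr 2; ring
  rw [e1, e2]
  have := Real.rpow_le_rpow_of_nonpos h0 hv (by linarith : -(p - t) ≤ 0)
  gcongr

lemma pw_high {q β α γ c0 L D ν κ : ℝ} (hq : 2 ≤ q) (hβ1 : β ≤ 1)
    (hc : 0 < c0) (hL : 0 ≤ L) (hD : 0 ≤ D) (hκ0 : 0 ≤ κ)
    (hκ : α + γ * (1 - β) - ν * (q - 2) = -κ)
    {r R v k a b : ℝ} (hR : 1 ≤ R) (hRr : R ≤ r) (hv : c0 * r ^ (-γ) ≤ v)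
    (hkl : k ≤ L * (r ^ α * v ^ β)) (ha : |a| ≤ D * r ^ (-ν)) :
    k * |a| ^ (q - 1) * |b| ≤ (L * c0 ^ (-(1 - β)) * D ^ (q - 2)) * R ^ (-κ) *
      (v * a ^ 2 + v * b ^ 2) := by
  have hr : 0 < r := by linarith
  have v0 : 0 < v := lt_of_lt_of_le (by positivity) hv
  have h1 := vpow_le (t := β) (p := 1) hc hr hv hβ1
  have h2 : |a| ^ (q - 1) ≤ D ^ (q - 2) * r ^ (-ν * (q - 2)) * |a| := by
    rw [show q - 1 = (q - 2) + 1 by ring,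
      Real.rpow_add_of_nonneg (abs_nonneg _) (by linarith) (by norm_num), Real.rpow_one]
    have : |a| ^ (q - 2) ≤ (D * r ^ (-ν)) ^ (q - 2) :=
      Real.rpow_le_rpow (abs_nonneg _) ha (by linarith)
    rw [Real.mul_rpow hD (by positivity), ← Real.rpow_mul hr.le] at this
    gcongr
  have h3 : r ^ (-κ) ≤ R ^ (-κ) :=
    Real.rpow_le_rpow_of_nonpos (by linarith) hRr (by linarith)
  have h4 : |a| * |b| ≤ a ^ 2 + b ^ 2 := by
    rw [← sq_abs a, ← sq_abs b]
    nlinarith [sq_nonneg (|a| - |b|), sq_nonneg |a|, sq_nonneg |b|]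
  have h5 : r ^ (-κ) = r ^ α * r ^ (γ * (1 - β)) * r ^ (-ν * (q - 2)) := by
    rw [← hκ, ← Real.rpow_add hr, ← Real.rpow_add hr]; congr 1; ring
  calc k * |a| ^ (q - 1) * |b|
      ≤ (L * (r ^ α * (v ^ (1 : ℝ) * (c0 ^ (-(1 - β)) * r ^ (γ * (1 - β)))))) *
        (D ^ (q - 2) * r ^ (-ν * (q - 2)) * |a|) * |b| := by
        have : k ≤ L * (r ^ α * (v ^ (1 : ℝ) * (c0 ^ (-(1 - β)) * r ^ (γ * (1 - β))))) :=
          hkl.trans (by gcongr)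
        gcongr
    _ = (L * c0 ^ (-(1 - β)) * D ^ (q - 2)) * r ^ (-κ) * (v * (|a| * |b|)) := by
        rw [h5, Real.rpow_one]; ring
    _ ≤ (L * c0 ^ (-(1 - β)) * D ^ (q - 2)) * R ^ (-κ) * (v * (a ^ 2 + b ^ 2)) := by
        gcongr
    _ = _ := by ring

lemma pw_low {q β α γ c0 L κ m : ℝ} (hq1 : 1 < q) (hq : q < 2) (hqβ : 2 * β < q)
    (hc : 0 < c0) (hL : 0 ≤ L) (hκ0 : 0 ≤ κ) (hm : 0 ≤ m)
    (hκ : α + γ * (q / 2 - β) = -κ + -m * ((2 - q) / 2))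
    {r R v k a b : ℝ} (hR : 1 ≤ R) (hRr : R ≤ r) (hv : c0 * r ^ (-γ) ≤ v)
    (hkl : k ≤ L * (r ^ α * v ^ β)) :
    k * |a| ^ (q - 1) * |b| ≤ (L * c0 ^ (-(q / 2 - β)) * 2 ^ m) * R ^ (-κ) *
      (v * a ^ 2 + v * b ^ 2 + (1 + r) ^ (-m)) := by
  have hr : 0 < r := by linarith
  have v0 : 0 < v := lt_of_lt_of_le (by positivity) hv
  have h1 := vpow_le (t := β) (p := q / 2) hc hr hv (by linarith)
  have h3 : r ^ (-κ) ≤ R ^ (-κ) :=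
    Real.rpow_le_rpow_of_nonpos (by linarith) hRr (by linarith)
  have h5 : r ^ α * r ^ (γ * (q / 2 - β)) = r ^ (-κ) * r ^ (-m * ((2 - q) / 2)) := by
    rw [← Real.rpow_add hr, ← Real.rpow_add hr, hκ]
  have am := Real.geom_mean_le_arith_mean3_weighted (w₁ := (q - 1) / 2) (w₂ := 1 / 2)
    (w₃ := (2 - q) / 2) (p₁ := v * a ^ 2) (p₂ := v * b ^ 2) (p₃ := r ^ (-m))
    (by linarith) (by norm_num) (by linarith) (by positivity) (by positivity) (by positivity)
    (by ring)
  have ep : ∀ (t p : ℝ), (v * t ^ 2) ^ (p / 2) = v ^ (p / 2) * |t| ^ p := by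
    intro t p
    rw [Real.mul_rpow v0.le (by positivity), ← sq_abs, ← Real.rpow_natCast,
      ← Real.rpow_mul (abs_nonneg _)]
    congr 2
    push_cast; ring
  rw [ep, ep, Real.rpow_one, ← Real.rpow_mul hr.le] at am
  have ev : v ^ (q / 2) = v ^ ((q - 1) / 2) * v ^ ((1 : ℝ) / 2) := by
    rw [← Real.rpow_add v0]; congr 1; ring
  have hrm : r ^ (-m) ≤ 2 ^ m * (1 + r) ^ (-m) := by
    have : (2 * r) ^ (-m) ≤ (1 + r) ^ (-m) :=
      Real.rpow_le_rpow_of_nonpos (by linarith) (by linarith) (by linarith)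
    rw [Real.mul_rpow (by norm_num) hr.le, Real.rpow_neg (by norm_num)] at this
    have t2 : (0 : ℝ) < 2 ^ m := by positivity
    calc r ^ (-m) = 2 ^ m * ((2 ^ m)⁻¹ * r ^ (-m)) := by field_simp
      _ ≤ _ := by gcongr
  have t1 : (1 : ℝ) ≤ 2 ^ m := Real.one_le_rpow (by norm_num) hm
  have am2 : v ^ ((q - 1) / 2) * |a| ^ (q - 1) * (v ^ ((1 : ℝ) / 2) * |b|) *
      r ^ (-m * ((2 - q) / 2)) ≤ 2 ^ m * (v * a ^ 2 + v * b ^ 2 + (1 + r) ^ (-m)) := by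
    refine am.trans ?_
    have p1 : 0 ≤ v * a ^ 2 := by positivity
    have p2 : 0 ≤ v * b ^ 2 := by positivity
    have p3 : 0 ≤ r ^ (-m) := by positivity
    nlinarith
  calc k * |a| ^ (q - 1) * |b|
      ≤ (L * (r ^ α * (v ^ (q / 2) * (c0 ^ (-(q / 2 - β)) * r ^ (γ * (q / 2 - β)))))) *
        |a| ^ (q - 1) * |b| := by
        have : k ≤ L * (r ^ α * (v ^ (q / 2) * (c0 ^ (-(q / 2 - β)) * r ^ (γ * (q / 2 - β))))) :=
          hkl.trans (by gcongr)
        gcongr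
    _ = (L * c0 ^ (-(q / 2 - β))) * (r ^ α * r ^ (γ * (q / 2 - β))) *
        (v ^ (q / 2) * |a| ^ (q - 1) * |b|) := by ring
    _ = (L * c0 ^ (-(q / 2 - β))) * r ^ (-κ) *
        (v ^ ((q - 1) / 2) * |a| ^ (q - 1) * (v ^ ((1 : ℝ) / 2) * |b|) *
      r ^ (-m * ((2 - q) / 2))) := by rw [h5, ev]; ring
    _ ≤ (L * c0 ^ (-(q / 2 - β))) * R ^ (-κ) *
        (2 ^ m * (v * a ^ 2 + v * b ^ 2 + (1 + r) ^ (-m))) := by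
        gcongr
    _ = _ := by ring

lemma pw_unif {N : ℕ} (hN : 5 ≤ N) {q β α γ c0 L D : ℝ} (hβ1 : β ≤ 1) (hγ : γ ≤ 4)
    (hc : 0 < c0) (hL : 0 ≤ L) (hD : 0 ≤ D)
    (hq1 : 1 < q) (hq2 : 2 * β < q) (hq3 : qLow N α β γ < q) (hq4 : qHigh N α β γ < q) :
    ∃ C κ m : ℝ, 0 ≤ C ∧ 0 < κ ∧ (N : ℝ) < m ∧ ∀ r R v k a b : ℝ, 1 ≤ R → R ≤ r →
      c0 * r ^ (-γ) ≤ v → k ≤ L * (r ^ α * v ^ β) → |a| ≤ D * r ^ (-(N / 2 - 1 - γ / 4) : ℝ) →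
      k * |a| ^ (q - 1) * |b| ≤ C * R ^ (-κ) * (v * a ^ 2 + v * b ^ 2 + (1 + r) ^ (-m)) := by
  have hN5 : (5 : ℝ) ≤ N := by exact_mod_cast hN
  rcases le_or_gt 2 q with h | h
  · unfold qHigh at hq4
    rw [div_lt_iff₀ (by linarith)] at hq4
    refine ⟨L * c0 ^ (-(1 - β)) * D ^ (q - 2),
      -(α + γ * (1 - β) - (N / 2 - 1 - γ / 4) * (q - 2)), N + 1, by positivity, by nlinarith,
      by linarith, ?_⟩
    intro r R v k a b hR hRr hv hkl ha
    have hr : 0 < r := by linarith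
    have := pw_high (b := b) (κ := -(α + γ * (1 - β) - (N / 2 - 1 - γ / 4) * (q - 2))) h hβ1 hc hL hD
      (by nlinarith) (by ring) hR hRr hv hkl ha
    refine this.trans ?_
    have p : 0 ≤ (1 + r) ^ (-((N : ℝ) + 1)) := by positivity
    exact mul_le_mul_of_nonneg_left (by linarith) (by positivity)
  · unfold qLow at hq3
    rw [div_lt_iff₀ (by linarith)] at hq3
    set e := α + γ * (q / 2 - β) with he
    set κ := (-2 * e - N * (2 - q)) / 4 with hκ
    have κ0 : 0 < κ := by rw [hκ, he]; nlinarith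
    set m := -(e + κ) * 2 / (2 - q) with hm
    have hmN : (N : ℝ) < m := by
      rw [hm, lt_div_iff₀ (by linarith)]; linarith
    refine ⟨L * c0 ^ (-(q / 2 - β)) * 2 ^ m, κ, m, by positivity, κ0, hmN, ?_⟩
    intro r R v k a b hR hRr hv hkl ha
    refine pw_low hq1 h hq2 hc hL κ0.le (by linarith) ?_ hR hRr hv hkl
    have : 2 - q ≠ 0 := by linarith
    rw [hm]; field_simp; ring

lemma H2norm_one {N : ℕ} {V : ℝ → ℝ≥0∞} {u w : E N → ℝ} (h : H2norm V u w = 1) :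
    ∫⁻ x : E N, ENNReal.ofReal ((w x) ^ 2) ≤ 1 ∧
    ∫⁻ x : E N, V ‖x‖ * ENNReal.ofReal ((u x) ^ 2) ≤ 1 := by
  unfold H2norm at h
  set S := (∫⁻ x : E N, ENNReal.ofReal ((w x) ^ 2)) +
    ∫⁻ x : E N, V ‖x‖ * ENNReal.ofReal ((u x) ^ 2) with hS
  have h1 : S.toReal = 1 := by
    rw [← Real.sqrt_eq_rpow] at h
    have := Real.sqrt_eq_one.mp h
    exact this
  have h2 : S = 1 := (ENNReal.toReal_eq_one_iff S).mp h1
  constructor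
  · rw [← h2, hS]; exact le_self_add
  · rw [← h2, hS]; exact le_add_self

lemma lower_V {V : ℝ → ℝ≥0∞} {R2 γ : ℝ} (hR2 : 0 < R2)
    (hinf : 0 < essInf (fun r : ℝ => ENNReal.ofReal r ^ γ * V r) (volume.restrict (Ioi R2))) :
    ∃ c0 : ℝ, 0 < c0 ∧
      ∀ᵐ r ∂(volume.restrict (Ioi R2)), ENNReal.ofReal (c0 * r ^ (-γ)) ≤ V r := by
  set I := essInf (fun r : ℝ => ENNReal.ofReal r ^ γ * V r) (volume.restrict (Ioi R2)) with hI
  have hf : min I 1 ≠ ⊤ := ne_top_of_le_ne_top (by simp) (min_le_right I 1)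
  have hp : 0 < (min I 1).toReal :=
    ENNReal.toReal_pos (lt_min hinf (by simp)).ne' hf
  refine ⟨(min I 1).toReal, hp, ?_⟩
  have h1 : ∀ᵐ r ∂(volume.restrict (Ioi R2)), I ≤ ENNReal.ofReal r ^ γ * V r := ae_essInf_le
  filter_upwards [h1, ae_restrict_mem measurableSet_Ioi] with r hr hr2
  have r0 : 0 < r := lt_trans hR2 hr2
  rw [ENNReal.ofReal_mul hp.le, ENNReal.ofReal_toReal hf]
  rw [ENNReal.ofReal_rpow_of_pos r0] at hr
  calc min I 1 * ENNReal.ofReal (r ^ (-γ)) ≤ (ENNReal.ofReal (r ^ γ) * V r) * ENNReal.ofReal (r ^ (-γ)) := by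
        gcongr; exact (min_le_left _ _).trans hr
    _ = (ENNReal.ofReal (r ^ γ) * ENNReal.ofReal (r ^ (-γ))) * V r := by ring
    _ = V r := by
        rw [← ENNReal.ofReal_mul (by positivity), ← Real.rpow_add r0]; simp

lemma upper_K {V : ℝ → ℝ≥0∞} {K : ℝ → ℝ} {R2 α β γ c0 : ℝ} (hR2 : 0 < R2) (hc : 0 < c0)
    (hess : essSup
      (fun r : ℝ => ENNReal.ofReal (K r) / (ENNReal.ofReal r ^ α * V r ^ β))
      (volume.restrict (Ioi R2)) < ⊤)
    (hVfin : ∀ᵐ r ∂(volume.restrict (Ioi R2)), V r < ⊤)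
    (hVl : ∀ᵐ r ∂(volume.restrict (Ioi R2)), ENNReal.ofReal (c0 * r ^ (-γ)) ≤ V r) :
    ∃ L : ℝ, 0 ≤ L ∧ ∀ᵐ r ∂(volume.restrict (Ioi R2)),
      V r = ENNReal.ofReal (V r).toReal ∧ c0 * r ^ (-γ) ≤ (V r).toReal ∧
      K r ≤ L * (r ^ α * (V r).toReal ^ β) := by
  set L := essSup
      (fun r : ℝ => ENNReal.ofReal (K r) / (ENNReal.ofReal r ^ α * V r ^ β))
      (volume.restrict (Ioi R2)) with hL
  refine ⟨L.toReal, ENNReal.toReal_nonneg, ?_⟩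
  have h1 : ∀ᵐ r ∂(volume.restrict (Ioi R2)),
    ENNReal.ofReal (K r) / (ENNReal.ofReal r ^ α * V r ^ β) ≤ L := ENNReal.ae_le_essSup _
  filter_upwards [h1, hVfin, hVl, ae_restrict_mem measurableSet_Ioi] with r hr hf hl hr2
  have r0 : 0 < r := lt_trans hR2 hr2
  have e : V r = ENNReal.ofReal (V r).toReal := (ENNReal.ofReal_toReal hf.ne).symm
  have hv : c0 * r ^ (-γ) ≤ (V r).toReal := (ENNReal.ofReal_le_iff_le_toReal hf.ne).mp hl
  refine ⟨e, hv, ?_⟩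
  have v0 : 0 < (V r).toReal := lt_of_lt_of_le (by positivity) hv
  rw [e, ENNReal.ofReal_rpow_of_pos r0, ENNReal.ofReal_rpow_of_pos v0,
    ← ENNReal.ofReal_mul (by positivity)] at hr
  have p : 0 < r ^ α * (V r).toReal ^ β := by positivity
  rw [ENNReal.div_le_iff (by simpa using p) (by simp), ← ENNReal.ofReal_toReal hess.ne,
    ← ENNReal.ofReal_mul ENNReal.toReal_nonneg] at hr
  exact (ENNReal.ofReal_le_ofReal_iff (by positivity)).mp hr

/-- Theorem 2.4: if moreover `ess inf_{r>R₂} r^{γ_∞}V(r) > 0` for some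
`γ_∞ ≤ 4`, then `R_∞(q₂,R) → 0` as `R → +∞` for all
`q₂ > max{1, 2β_∞, q_*(α_∞,β_∞,γ_∞), q_{**}(α_∞,β_∞,γ_∞)}`. -/
theorem stmt6 (N : ℕ) (hN : 5 ≤ N) (V : ℝ → ℝ≥0∞) (K : ℝ → ℝ) (s : ℝ)
    (hV : HypV V) (hK : HypK K s) (R2 : ℝ) (hR2 : 0 < R2)
    (β' α' γ' : ℝ) (hβ' : 0 ≤ β') (hβ'' : β' ≤ 1) (hγ' : γ' ≤ 4)
    (hVfin : ∀ᵐ r ∂(volume.restrict (Set.Ioi R2)), V r < ⊤)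
    (hess : essSup
      (fun r : ℝ => ENNReal.ofReal (K r) / (ENNReal.ofReal r ^ α' * V r ^ β'))
      (volume.restrict (Set.Ioi R2)) < ⊤)
    (hinf : 0 < essInf (fun r : ℝ => ENNReal.ofReal r ^ γ' * V r)
      (volume.restrict (Set.Ioi R2))) :
    ∀ q2 : ℝ, max (max (max 1 (2*β')) (qLow N α' β' γ')) (qHigh N α' β' γ') < q2 →
      Tendsto (fun R => Rinf N V K q2 R) atTop (𝓝 0) := by
  intro q hq
  simp only [max_lt_iff] at hq
  obtain ⟨⟨⟨hq1, hq2⟩, hq3⟩, hq4⟩ := hq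
  obtain ⟨c0, hc, hVl⟩ := lower_V hR2 hinf
  obtain ⟨L, hL, hKL⟩ := upper_K hR2 hc hess hVfin hVl
  have hD : 0 ≤ 2 + 2 * Dloc N γ' c0 + Ckey N := by
    have := Dloc_nonneg (N := N) (γ := γ') hc
    have := Ckey_pos hN
    linarith
  obtain ⟨C, κ, m, hC, hκ, hm, pw⟩ := pw_unif hN hβ'' hγ' hc hL hD hq1 hq2 hq3 hq4
  set I := ∫⁻ x : E N, ENNReal.ofReal ((1 + ‖x‖) ^ (-m)) with hI
  have hIf : I < ⊤ := finite_integral_one_add_norm (by simpa using hm)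
  have key : ∀ R : ℝ, 1 ≤ R → 2 * R2 < R → Rinf N V K q R ≤ ENNReal.ofReal (C * R ^ (-κ)) * (1 + 1 + I) := by
    intro R hR1 hR
    unfold Rinf
    refine iSup_le ?_
    rintro ⟨⟨⟨u, wu⟩, ⟨h, wh⟩⟩, hu, hh, nu, nh⟩
    simp only at hu hh nu nh ⊢
    obtain ⟨u1, u2⟩ := H2norm_one nu
    obtain ⟨h1, h2⟩ := H2norm_one nh
    have hdec := decay hN hu.1.1 hu.2 u1 hc hγ' hVl u2
    have mV : Measurable (fun x : E N => V ‖x‖) := hV.1.comp measurable_norm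
    have mu : AEMeasurable u volume := hu.1.1.1.1.aemeasurable
    have mh : AEMeasurable h volume := hh.1.1.1.1.aemeasurable
    have fu : AEMeasurable (fun x : E N => V ‖x‖ * ENNReal.ofReal ((u x) ^ 2)) volume :=
      mV.aemeasurable.mul (mu.pow_const 2).ennreal_ofReal
    have fh : AEMeasurable (fun x : E N => V ‖x‖ * ENNReal.ofReal ((h x) ^ 2)) volume :=
      mV.aemeasurable.mul (mh.pow_const 2).ennreal_ofReal
    calc ∫⁻ x in (Metric.ball (0 : E N) R)ᶜ, ENNReal.ofReal (K ‖x‖ * |u x| ^ (q - 1) * |h x|)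
        ≤ ∫⁻ x in (Metric.ball (0 : E N) R)ᶜ, ENNReal.ofReal (C * R ^ (-κ)) *
            (V ‖x‖ * ENNReal.ofReal ((u x) ^ 2) + V ‖x‖ * ENNReal.ofReal ((h x) ^ 2)
              + ENNReal.ofReal ((1 + ‖x‖) ^ (-m))) := by
          apply lintegral_mono_ae
          filter_upwards [ae_restrict_of_ae hdec, ae_restrict_of_ae (ae_norm_tail hN hKL),
            ae_restrict_mem Metric.isOpen_ball.measurableSet.compl] with x hx1 hx2 hx3
          have hRx : R ≤ ‖x‖ := by simpa using hx3
          obtain ⟨e, hv, hk⟩ := hx2 (by linarith)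
          have p := pw ‖x‖ R (V ‖x‖).toReal (K ‖x‖) (u x) (h x) hR1 hRx hv hk
            (hx1 (by linarith) (by linarith))
          have pos : 0 < 1 + ‖x‖ := by linarith
          rw [e, ← ENNReal.ofReal_mul toReal_nonneg, ← ENNReal.ofReal_mul toReal_nonneg,
            ← ENNReal.ofReal_add (by positivity) (by positivity),
            ← ENNReal.ofReal_add (by positivity) (by positivity),
            ← ENNReal.ofReal_mul (by positivity)]
          exact ENNReal.ofReal_le_ofReal p
      _ ≤ ∫⁻ x : E N, ENNReal.ofReal (C * R ^ (-κ)) *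
            (V ‖x‖ * ENNReal.ofReal ((u x) ^ 2) + V ‖x‖ * ENNReal.ofReal ((h x) ^ 2)
              + ENNReal.ofReal ((1 + ‖x‖) ^ (-m))) := setLIntegral_le_lintegral _ _
      _ ≤ ENNReal.ofReal (C * R ^ (-κ)) * (1 + 1 + I) := by
          have fuh : AEMeasurable (fun x : E N => V ‖x‖ * ENNReal.ofReal ((u x) ^ 2) +
            V ‖x‖ * ENNReal.ofReal ((h x) ^ 2)) volume := fu.add fh
          rw [lintegral_const_mul' _ _ (by simp), lintegral_add_left' fuh,
            lintegral_add_left' fu]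
          gcongr
  have lim : Tendsto (fun R : ℝ => ENNReal.ofReal (C * R ^ (-κ)) * (1 + 1 + I)) atTop (𝓝 0) := by
    have t1 : Tendsto (fun R : ℝ => C * R ^ (-κ)) atTop (𝓝 0) := by
      simpa using (tendsto_rpow_neg_atTop hκ).const_mul C
    have t2 := ENNReal.tendsto_ofReal t1
    rw [ENNReal.ofReal_zero] at t2
    have t3 := ENNReal.Tendsto.mul_const (b := 1 + 1 + I) t2 (Or.inr (by simp [hIf.ne]))
    simpa using t3
  refine tendsto_of_tendsto_of_tendsto_of_le_of_le' tendsto_const_nhds lim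
    (Eventually.of_forall fun _ => zero_le) ?_
  filter_upwards [eventually_ge_atTop 1, eventually_gt_atTop (2 * R2)] with R a b
  exact key R a b

end
end

section
/- Assume hypotheses (V) and (K). Let Ω ⊆ ℝ^N be a nonempty measurable set with V(|x|) < +∞ almost everywhere on Ω, and suppose Λ := ess sup_{x∈Ω} K(|x|)/(|x|^α V(|x|)^β) < +∞ for some 0 ≤ β ≤ 1 and α ∈ ℝ. Let u ∈ H²_V satisfy |u(x)| ≤ m/|x|^ν for a.e. x ∈ Ω, for some ν ∈ ℝ and m > 0. Then for every h ∈ H²_V and every q > max{1, 2β}: (i) if 0 ≤ β ≤ 1/2, ∫_Ω K(|x|)|u|^{q−1}|h| dx ≤ Λ m^{q−1} S_N^{1−2β} (∫_Ω |x|^{2N(α−ν(q−1))/(N+4(1−2β))} dx)^{(N+4(1−2β))/(2N)} ‖h‖; (ii) if 1/2 < β < 1, ∫_Ω K(|x|)|u|^{q−1}|h| dx ≤ Λ m^{q−2β} (∫_Ω |x|^{(α−ν(q−2β))/(1−β)} dx)^{1−β} ‖u‖^{2β−1} ‖h‖; (iii) if β = 1, ∫_Ω K(|x|)|u|^{q−1}|h|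 dx ≤ Λ m^{q−2} (∫_Ω |x|^{2α−2ν(q−2)} V(|x|)|u|² dx)^{1/2} ‖h‖. -/
open MeasureTheory Filter Topology Set ENNReal

theorem aux_holder3 {Y : Type*} [MeasurableSpace Y] (μ : Measure Y) (f g k : Y → ℝ≥0∞)
    (hf : AEMeasurable f μ) (hg : AEMeasurable g μ) (hk : AEMeasurable k μ)
    (a b c : ℝ) (ha : 0 ≤ a) (hb : 0 ≤ b) (hc : 0 ≤ c) (habc : a + b + c = 1) :
    ∫⁻ x, f x ^ a * g x ^ b * k x ^ c ∂μ ≤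
      (∫⁻ x, f x ∂μ) ^ a * (∫⁻ x, g x ∂μ) ^ b * (∫⁻ x, k x ∂μ) ^ c := by
  have := ENNReal.lintegral_prod_norm_pow_le (μ := μ) (Finset.univ : Finset (Fin 3))
    (f := ![f, g, k]) (by intro i _; fin_cases i <;> simpa) (p := ![a, b, c])
    (by simp [Fin.sum_univ_three, habc]) (by intro i _; fin_cases i <;> simpa)
  simpa [Fin.prod_univ_three] using this

theorem aux_point (k r U H α β ν m t e : ℝ) (V : ℝ≥0∞) (Λ : ℝ≥0∞) (hr : 0 < r) (hk : 0 < k)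
    (hm : 0 < m) (ht : 0 ≤ t) (he : 0 ≤ e) (hβ : 0 ≤ β)
    (hV : V < ⊤) (hΛ : Λ < ⊤)
    (h1 : ENNReal.ofReal k / (ENNReal.ofReal r ^ α * V ^ β) ≤ Λ)
    (h2 : |U| ≤ m / r ^ ν) :
    ENNReal.ofReal (k * |U| ^ (t + e) * |H|) ≤
      (Λ * ENNReal.ofReal m ^ t) *
        (ENNReal.ofReal r ^ (α - ν * t) * V ^ β * ENNReal.ofReal |U| ^ e * ENNReal.ofReal |H|) := by
  have hX0 : ENNReal.ofReal r ≠ 0 := by simpa using hr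
  have hXt : ENNReal.ofReal r ≠ ⊤ := ENNReal.ofReal_ne_top
  have hd : ENNReal.ofReal r ^ α * V ^ β ≠ ⊤ :=
    ENNReal.mul_ne_top (ENNReal.rpow_ne_top_of_ne_zero hX0 hXt) (ENNReal.rpow_ne_top_of_nonneg hβ hV.ne)
  have hd0 : ENNReal.ofReal r ^ α * V ^ β ≠ 0 := by
    intro h0
    rw [h0, ENNReal.div_zero (by simpa using hk)] at h1
    exact absurd h1 (not_le.2 hΛ)
  have hK := (ENNReal.div_le_iff hd0 hd).1 h1
  have hU : ENNReal.ofReal |U| ≤ ENNReal.ofReal m * ENNReal.ofReal r ^ (-ν) := by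
    rw [ENNReal.ofReal_rpow_of_pos hr, ← ENNReal.ofReal_mul hm.le]
    apply ENNReal.ofReal_le_ofReal
    rwa [Real.rpow_neg hr.le, ← div_eq_mul_inv]
  have hUt : ENNReal.ofReal |U| ^ t ≤ ENNReal.ofReal m ^ t * ENNReal.ofReal r ^ (-ν * t) := by
    rw [ENNReal.rpow_mul, ← ENNReal.mul_rpow_of_nonneg _ _ ht]
    exact ENNReal.rpow_le_rpow hU ht
  rw [ENNReal.ofReal_mul (by positivity), ENNReal.ofReal_mul hk.le,
    ← ENNReal.ofReal_rpow_of_nonneg (abs_nonneg _) (by positivity),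
    ENNReal.rpow_add_of_nonneg _ _ ht he]
  calc _ ≤ (Λ * (ENNReal.ofReal r ^ α * V ^ β)) *
        ((ENNReal.ofReal m ^ t * ENNReal.ofReal r ^ (-ν * t)) * ENNReal.ofReal |U| ^ e)
          * ENNReal.ofReal |H| := by gcongr
    _ = _ := by
      rw [sub_eq_add_neg, ENNReal.rpow_add _ _ hX0 hXt, ← neg_mul]
      ring

theorem aux_norm {N : ℕ} (V : ℝ → ℝ≥0∞) (u w : E N → ℝ) (hu : MemH2V V u w) :
    (∫⁻ x : E N, V ‖x‖ * ENNReal.ofReal ((u x) ^ 2)) ≤ ENNReal.ofReal (H2norm V u w) ^ (2:ℝ) := by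
  have hw : (∫⁻ x : E N, ENNReal.ofReal ((w x) ^ 2)) < ⊤ := by
    have := hu.1.2.1.integrable_sq
    exact this.lintegral_lt_top
  have hs := ENNReal.add_lt_top.2 ⟨hw, hu.2⟩
  unfold H2norm
  rw [ENNReal.ofReal_rpow_of_nonneg (by positivity) (by norm_num), ← Real.rpow_mul (by positivity)]
  norm_num
  rw [ENNReal.ofReal_toReal hs.ne]
  exact le_add_self

theorem aux_sq (V : ℝ≥0∞) (a b : ℝ) (hb : 0 ≤ b) :
    (V * ENNReal.ofReal (a ^ 2)) ^ b = V ^ b * ENNReal.ofReal |a| ^ (2 * b) := by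
  rw [ENNReal.mul_rpow_of_nonneg _ _ hb, ENNReal.rpow_mul, ← sq_abs,
    ENNReal.ofReal_pow (abs_nonneg _)]
  norm_num

/-- Lemma 4.1: let `Ω ⊆ ℝ^N` be nonempty measurable with `V(|x|) < ∞`
a.e. on `Ω` and `Λ = ess sup_Ω K(|x|)/(|x|^α V(|x|)^β) < ∞` with `0 ≤ β ≤ 1`.
If `u ∈ H²_V` satisfies `|u(x)| ≤ m|x|^{-ν}` a.e. on `Ω`, then for all `h ∈ H²_V` and
`q > max{1,2β}`, the integral `∫_Ω K(|x|)|u|^{q-1}|h| dx` enjoys the three bounds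
according to `β ≤ 1/2`, `1/2 < β < 1`, `β = 1`. -/
theorem stmt10 (N : ℕ) (hN : 5 ≤ N) (V : ℝ → ℝ≥0∞) (K : ℝ → ℝ) (s : ℝ)
    (hV : HypV V) (hK : HypK K s)
    (SN : ℝ) (hSN : 0 < SN)
    (hSob : ∀ v z : E N → ℝ, MemH2V V v z →
      eLpNorm v (twoSS N) volume ≤ ENNReal.ofReal (SN * H2norm V v z))
    (Ω : Set (E N)) (hΩmeas : MeasurableSet Ω) (hΩne : Ω.Nonempty)
    (hVfin : ∀ᵐ x ∂(volume.restrict Ω), V ‖x‖ < ⊤)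
    (α β : ℝ) (hβ : 0 ≤ β) (hβ' : β ≤ 1)
    (hΛ : essSup (fun x : E N =>
        ENNReal.ofReal (K ‖x‖) / (ENNReal.ofReal ‖x‖ ^ α * V ‖x‖ ^ β))
      (volume.restrict Ω) < ⊤)
    (u w : E N → ℝ) (hu : MemH2V V u w)
    (ν m : ℝ) (hm : 0 < m)
    (hbd : ∀ᵐ x ∂(volume.restrict Ω), |u x| ≤ m / ‖x‖ ^ ν) :
    ∀ h z : E N → ℝ, MemH2V V h z → ∀ q : ℝ, max 1 (2*β) < q →
      (β ≤ 1/2 →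
        (∫⁻ x in Ω, ENNReal.ofReal (K ‖x‖ * |u x| ^ (q-1) * |h x|)) ≤
          essSup (fun x : E N =>
              ENNReal.ofReal (K ‖x‖) / (ENNReal.ofReal ‖x‖ ^ α * V ‖x‖ ^ β))
            (volume.restrict Ω) *
          ENNReal.ofReal m ^ (q-1) * ENNReal.ofReal SN ^ (1-2*β) *
          (∫⁻ x in Ω, ENNReal.ofReal ‖x‖ ^ ((α - ν*(q-1)) / (N + 4*(1-2*β)) * (2*N)))
            ^ ((N + 4*(1-2*β)) / (2*(N:ℝ))) *
          ENNReal.ofReal (H2norm V h z)) ∧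
      (1/2 < β → β < 1 →
        (∫⁻ x in Ω, ENNReal.ofReal (K ‖x‖ * |u x| ^ (q-1) * |h x|)) ≤
          essSup (fun x : E N =>
              ENNReal.ofReal (K ‖x‖) / (ENNReal.ofReal ‖x‖ ^ α * V ‖x‖ ^ β))
            (volume.restrict Ω) *
          ENNReal.ofReal m ^ (q-2*β) *
          (∫⁻ x in Ω, ENNReal.ofReal ‖x‖ ^ ((α - ν*(q-2*β)) / (1-β))) ^ (1-β) *
          ENNReal.ofReal (H2norm V u w) ^ (2*β-1) *
          ENNReal.ofReal (H2norm V h z)) ∧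
      (β = 1 →
        (∫⁻ x in Ω, ENNReal.ofReal (K ‖x‖ * |u x| ^ (q-1) * |h x|)) ≤
          essSup (fun x : E N =>
              ENNReal.ofReal (K ‖x‖) / (ENNReal.ofReal ‖x‖ ^ α * V ‖x‖ ^ β))
            (volume.restrict Ω) *
          ENNReal.ofReal m ^ (q-2) *
          (∫⁻ x in Ω, ENNReal.ofReal ‖x‖ ^ (2*α - 2*ν*(q-2)) * V ‖x‖ *
              ENNReal.ofReal ((u x) ^ 2)) ^ ((1:ℝ)/2) *
          ENNReal.ofReal (H2norm V h z)) := by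
  intro h z hh q hq
  obtain ⟨hq1, hq2⟩ := max_lt_iff.1 hq
  set Λ := essSup (fun x : E N =>
        ENNReal.ofReal (K ‖x‖) / (ENNReal.ofReal ‖x‖ ^ α * V ‖x‖ ^ β))
      (volume.restrict Ω) with hΛdef
  have : Nonempty (Fin N) := ⟨⟨0, by omega⟩⟩
  have hne : ∀ᵐ x ∂((volume : Measure (E N)).restrict Ω), x ≠ 0 :=
    ae_restrict_of_ae (Measure.ae_ne volume 0)
  have hle : ∀ᵐ x ∂((volume : Measure (E N)).restrict Ω),
      ENNReal.ofReal (K ‖x‖) / (ENNReal.ofReal ‖x‖ ^ α * V ‖x‖ ^ β) ≤ Λ :=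
    ENNReal.ae_le_essSup _
  have hN5 : (5:ℝ) ≤ N := by exact_mod_cast hN
  have huM : AEMeasurable u volume := hu.1.1.1.aemeasurable
  have hhM : AEMeasurable h volume := hh.1.1.1.aemeasurable
  have hVM : AEMeasurable (fun x : E N => V ‖x‖) volume :=
    (hV.1.comp measurable_norm).aemeasurable
  have hVu : AEMeasurable (fun x : E N => V ‖x‖ * ENNReal.ofReal ((u x) ^ 2))
      (volume.restrict Ω) :=
    (hVM.mul (huM.pow_const 2).ennreal_ofReal).restrict
  have hVh : AEMeasurable (fun x : E N => V ‖x‖ * ENNReal.ofReal ((h x) ^ 2))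
      (volume.restrict Ω) :=
    (hVM.mul (hhM.pow_const 2).ennreal_ofReal).restrict
  have hX : ∀ p : ℝ, AEMeasurable (fun x : E N => ENNReal.ofReal ‖x‖ ^ p)
      (volume.restrict Ω) := fun p =>
    ((measurable_norm.ennreal_ofReal).pow_const p).aemeasurable
  have hnu : (∫⁻ x in Ω, V ‖x‖ * ENNReal.ofReal ((u x) ^ 2)) ≤
      ENNReal.ofReal (H2norm V u w) ^ (2:ℝ) :=
    (setLIntegral_le_lintegral _ _).trans (aux_norm V u w hu)
  have hnh : (∫⁻ x in Ω, V ‖x‖ * ENNReal.ofReal ((h x) ^ 2)) ≤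
      ENNReal.ofReal (H2norm V h z) ^ (2:ℝ) :=
    (setLIntegral_le_lintegral _ _).trans (aux_norm V h z hh)
  have key : ∀ t e : ℝ, 0 ≤ t → 0 ≤ e → t + e = q - 1 →
      (∫⁻ x in Ω, ENNReal.ofReal (K ‖x‖ * |u x| ^ (q-1) * |h x|)) ≤
        (Λ * ENNReal.ofReal m ^ t) * ∫⁻ x in Ω,
          (ENNReal.ofReal ‖x‖ ^ (α - ν * t) * V ‖x‖ ^ β * ENNReal.ofReal |u x| ^ e
            * ENNReal.ofReal |h x|) := by
    intro t e ht he hte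
    rw [← lintegral_const_mul' _ _ (ENNReal.mul_ne_top hΛ.ne
      (ENNReal.rpow_ne_top_of_nonneg ht ENNReal.ofReal_ne_top))]
    apply lintegral_mono_ae
    filter_upwards [hne, hle, hVfin, hbd] with x h1 h2 h3 h4
    have hr : 0 < ‖x‖ := norm_pos_iff.2 h1
    rw [← hte]
    exact aux_point (K ‖x‖) ‖x‖ (u x) (h x) α β ν m t e (V ‖x‖) Λ hr (hK.1 _ hr) hm ht he hβ
      h3 hΛ h2 h4
  refine ⟨fun hb => ?_, fun hb1 hb2 => ?_, fun hb => ?_⟩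
  · have hD : (0:ℝ) < N + 4*(1-2*β) := by nlinarith
    have hts : (twoSS N).toReal = 2 * N / (N - 4) := by
      have h4 : ((4:ℕ):ℝ≥0∞) = 4 := by norm_num
      unfold twoSS
      rw [ENNReal.toReal_div, ← h4, ← ENNReal.natCast_sub, ENNReal.toReal_natCast,
        Nat.cast_sub (by omega)]
      simp
    have hpos : 0 < (twoSS N).toReal := by
      rw [hts]; apply div_pos <;> linarith
    have hts0 : twoSS N ≠ 0 := fun h0 => by simp [h0] at hpos
    have htst : twoSS N ≠ ⊤ := fun h0 => by simp [h0] at hpos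
    set p := (twoSS N).toReal with hp
    have hnh3 : (∫⁻ x in Ω, ENNReal.ofReal |h x| ^ p) ≤
        ENNReal.ofReal (SN * H2norm V h z) ^ p := by
      refine (setLIntegral_le_lintegral _ _).trans ?_
      have h5 := hSob h z hh
      rw [eLpNorm_eq_lintegral_rpow_enorm_toReal hts0 htst, ← hp] at h5
      have h6 := ENNReal.rpow_le_rpow h5 hpos.le
      rw [← ENNReal.rpow_mul, one_div, inv_mul_cancel₀ hpos.ne', ENNReal.rpow_one] at h6
      simpa [Real.enorm_eq_ofReal_abs] using h6
    have hk := key (q-1) 0 (by linarith) le_rfl (by ring)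
    refine hk.trans ?_
    have hH := aux_holder3 ((volume : Measure (E N)).restrict Ω)
      (fun x => ENNReal.ofReal ‖x‖ ^ ((α - ν*(q-1)) / (N + 4*(1-2*β)) * (2*N)))
      (fun x => V ‖x‖ * ENNReal.ofReal ((h x) ^ 2))
      (fun x => ENNReal.ofReal |h x| ^ p) (hX _) hVh
      ((hhM.abs.ennreal_ofReal.pow_const p).restrict)
      ((N + 4*(1-2*β)) / (2*(N:ℝ))) β ((1-2*β)/p) (by positivity) hβ
      (div_nonneg (by linarith) hpos.le) (by
        rw [hts]
        have : (N:ℝ) - 4 ≠ 0 := by linarith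
        field_simp
        ring)
    have heq : ∀ x : E N, (ENNReal.ofReal ‖x‖ ^ (α - ν * (q-1)) * V ‖x‖ ^ β *
          ENNReal.ofReal |u x| ^ (0:ℝ) * ENNReal.ofReal |h x|) =
        (ENNReal.ofReal ‖x‖ ^ ((α - ν*(q-1)) / (N + 4*(1-2*β)) * (2*N)))
            ^ ((N + 4*(1-2*β)) / (2*(N:ℝ))) *
          (V ‖x‖ * ENNReal.ofReal ((h x) ^ 2)) ^ β * (ENNReal.ofReal |h x| ^ p) ^ ((1-2*β)/p) := by
      intro x
      rw [aux_sq _ _ _ hβ, ← ENNReal.rpow_mul, ← ENNReal.rpow_mul]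
      have e1 : (α - ν*(q-1)) / (N + 4*(1-2*β)) * (2*N) * ((N + 4*(1-2*β)) / (2*(N:ℝ)))
        = α - ν*(q-1) := by field_simp
      have e2 : p * ((1-2*β)/p) = 1 - 2*β := by field_simp
      rw [e1, e2, ENNReal.rpow_zero, mul_one]
      have e3 : ENNReal.ofReal |h x| = ENNReal.ofReal |h x| ^ (2*β) *
          ENNReal.ofReal |h x| ^ (1-2*β) := by
        rw [← ENNReal.rpow_add_of_nonneg _ _ (by linarith) (by linarith)]
        simp
      conv_lhs => rw [e3]
      ring
    simp_rw [heq]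
    have hfin : (∫⁻ x in Ω, V ‖x‖ * ENNReal.ofReal ((h x) ^ 2)) ^ β *
        (∫⁻ x in Ω, ENNReal.ofReal |h x| ^ p) ^ ((1-2*β)/p) ≤
        ENNReal.ofReal SN ^ (1-2*β) * ENNReal.ofReal (H2norm V h z) := by
      calc _ ≤ (ENNReal.ofReal (H2norm V h z) ^ (2:ℝ)) ^ β *
            (ENNReal.ofReal (SN * H2norm V h z) ^ p) ^ ((1-2*β)/p) := by
              gcongr
              exact div_nonneg (by linarith) hpos.le
        _ = _ := by
          have e2 : p * ((1-2*β)/p) = 1 - 2*β := by field_simp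
          rw [← ENNReal.rpow_mul, ← ENNReal.rpow_mul, e2, ENNReal.ofReal_mul hSN.le,
            ENNReal.mul_rpow_of_nonneg _ _ (by linarith), mul_left_comm,
            ← ENNReal.rpow_add_of_nonneg _ _ (by linarith) (by linarith)]
          simp
    calc _ ≤ _ := mul_le_mul_right hH _
      _ ≤ _ := by
        rw [mul_assoc ((∫⁻ x in Ω, _) ^ _)]
        refine (mul_le_mul_right (mul_le_mul_right hfin _) _).trans (le_of_eq ?_)
        ring
  · refine (key (q-2*β) (2*β-1) (by linarith) (by linarith) (by ring)).trans ?_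
    have hH := aux_holder3 ((volume : Measure (E N)).restrict Ω)
      (fun x => ENNReal.ofReal ‖x‖ ^ ((α - ν*(q-2*β)) / (1-β)))
      (fun x => V ‖x‖ * ENNReal.ofReal ((u x) ^ 2))
      (fun x => V ‖x‖ * ENNReal.ofReal ((h x) ^ 2)) (hX _) hVu hVh
      (1-β) (β-1/2) (1/2) (by linarith) (by linarith) (by norm_num) (by ring)
    have heq : ∀ x : E N, (ENNReal.ofReal ‖x‖ ^ (α - ν * (q-2*β)) * V ‖x‖ ^ β *
          ENNReal.ofReal |u x| ^ (2*β-1) * ENNReal.ofReal |h x|) =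
        (ENNReal.ofReal ‖x‖ ^ ((α - ν*(q-2*β)) / (1-β))) ^ (1-β) *
          (V ‖x‖ * ENNReal.ofReal ((u x) ^ 2)) ^ (β-1/2) *
          (V ‖x‖ * ENNReal.ofReal ((h x) ^ 2)) ^ ((1:ℝ)/2) := by
      intro x
      rw [aux_sq _ _ _ (by linarith), aux_sq _ _ _ (by norm_num), ← ENNReal.rpow_mul,
        div_mul_cancel₀ _ (by linarith)]
      have e3 : V ‖x‖ ^ β = V ‖x‖ ^ (β - 1/2) * V ‖x‖ ^ ((1:ℝ)/2) := by
        rw [← ENNReal.rpow_add_of_nonneg _ _ (by linarith) (by norm_num)]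
        simp
      have e4 : 2 * (β - 1/2) = 2*β - 1 := by ring
      have e5 : (2:ℝ) * (1/2) = 1 := by norm_num
      rw [e3, e4, e5, ENNReal.rpow_one]
      ring
    simp_rw [heq]
    have hfin : (∫⁻ x in Ω, V ‖x‖ * ENNReal.ofReal ((u x) ^ 2)) ^ (β-1/2) *
        (∫⁻ x in Ω, V ‖x‖ * ENNReal.ofReal ((h x) ^ 2)) ^ ((1:ℝ)/2) ≤
        ENNReal.ofReal (H2norm V u w) ^ (2*β-1) * ENNReal.ofReal (H2norm V h z) := by
      calc _ ≤ (ENNReal.ofReal (H2norm V u w) ^ (2:ℝ)) ^ (β-1/2) *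
            (ENNReal.ofReal (H2norm V h z) ^ (2:ℝ)) ^ ((1:ℝ)/2) :=
              mul_le_mul' (ENNReal.rpow_le_rpow hnu (by linarith))
                (ENNReal.rpow_le_rpow hnh (by norm_num))
        _ = _ := by
          have e4 : 2 * (β - 1/2) = 2*β - 1 := by ring
          have e5 : (2:ℝ) * (1/2) = 1 := by norm_num
          rw [← ENNReal.rpow_mul, ← ENNReal.rpow_mul, e4, e5, ENNReal.rpow_one]
    calc _ ≤ _ := mul_le_mul_right hH _
      _ ≤ _ := by
        rw [mul_assoc ((∫⁻ x in Ω, _) ^ _)]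
        refine (mul_le_mul_right (mul_le_mul_right hfin _) _).trans (le_of_eq ?_)
        ring
  · rw [hb] at hq2
    refine (key (q-2) 1 (by linarith) (by norm_num) (by ring)).trans ?_
    have hH := aux_holder3 ((volume : Measure (E N)).restrict Ω)
      (fun x => ENNReal.ofReal ‖x‖ ^ (2*α - 2*ν*(q-2)) * V ‖x‖ * ENNReal.ofReal ((u x) ^ 2))
      (fun x => V ‖x‖ * ENNReal.ofReal ((h x) ^ 2))
      (fun x => 1) (by simp only [mul_assoc]; exact (hX _).mul hVu) hVh aemeasurable_const
      (1/2) (1/2) 0 (by norm_num) (by norm_num) (by norm_num) (by norm_num)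
    simp only [ENNReal.rpow_zero, mul_one] at hH
    have heq : ∀ x : E N, (ENNReal.ofReal ‖x‖ ^ (α - ν * (q-2)) * V ‖x‖ ^ β *
          ENNReal.ofReal |u x| ^ (1:ℝ) * ENNReal.ofReal |h x|) =
        (ENNReal.ofReal ‖x‖ ^ (2*α - 2*ν*(q-2)) * V ‖x‖ * ENNReal.ofReal ((u x) ^ 2))
            ^ ((1:ℝ)/2) *
          (V ‖x‖ * ENNReal.ofReal ((h x) ^ 2)) ^ ((1:ℝ)/2) := by
      intro x
      rw [mul_assoc (ENNReal.ofReal ‖x‖ ^ (2*α - 2*ν*(q-2))),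
        ENNReal.mul_rpow_of_nonneg _ (V ‖x‖ * _) (by norm_num),
        aux_sq _ _ _ (by norm_num), aux_sq _ _ _ (by norm_num), ← ENNReal.rpow_mul]
      have e3 : V ‖x‖ ^ β = V ‖x‖ ^ ((1:ℝ)/2) * V ‖x‖ ^ ((1:ℝ)/2) := by
        rw [← ENNReal.rpow_add_of_nonneg _ _ (by norm_num) (by norm_num), hb]
        norm_num
      have e4 : (2*α - 2*ν*(q-2)) * (1/2) = α - ν * (q-2) := by ring
      have e5 : (2:ℝ) * (1/2) = 1 := by norm_num
      rw [e3, e4, e5, ENNReal.rpow_one, ENNReal.rpow_one]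
      ring
    simp_rw [heq]
    have hfin : (∫⁻ x in Ω, V ‖x‖ * ENNReal.ofReal ((h x) ^ 2)) ^ ((1:ℝ)/2) ≤
        ENNReal.ofReal (H2norm V h z) := by
      refine (ENNReal.rpow_le_rpow hnh (by norm_num)).trans (le_of_eq ?_)
      rw [← ENNReal.rpow_mul]
      norm_num
    calc _ ≤ _ := mul_le_mul_right hH _
      _ ≤ _ := by
        refine (mul_le_mul_right (mul_le_mul_right hfin _) _).trans (le_of_eq ?_)
        ring
end
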